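/- Let T be a complete arithmetically definable theory in a countable arithmetically definable language with no finite models, let M ⊨ T be arithmetically extendible, let A ⊆ M be arithmetical, and let p(x̄) be an n-type over A inside M. Then the following are equivalent: (1) p is an arithmetic n-type over A inside M; (2) some arithmetically decidable elementary extension of M realizes p; (3) some arithmetically extendible elementary extension of M realizes p. -/

import Mathlib

open FirstOrder FirstOrder.Language

namespace ArMorley

/-! ## Arithmetical sets and arithmetic reducibility -/

/-- Function symbols of the language of arithmetic: `0`, `1`, `+`, `·`. -/
inductive ArFunc : ℕ → Type
  | zero : ArFunc 0
  | one : ArFunc 0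
  | add : ArFunc 2
  | mul : ArFunc 2

/-- Relation symbols: `<` and a unary oracle predicate. -/
inductive ArRel : ℕ → Type
  | lt : ArRel 2
  | mem : ArRel 1

/-- The language `(+, ·, 0, 1, <, Y)` of arithmetic with a unary oracle predicate. -/
def arithLang : FirstOrder.Language := ⟨ArFunc, ArRel⟩

/-- The standard structure on `ℕ`, with the oracle predicate interpreted by `Y`. -/
def arithStructure (Y : Set ℕ) : arithLang.Structure ℕ where
  funMap := fun {n} f =>
    match f with
    | ArFunc.zero => fun _ => 0
    | ArFunc.one => fun _ => 1
    | ArFunc.add => fun v => v 0 + v 1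
    | ArFunc.mul => fun v => v 0 * v 1
  RelMap := fun {n} r =>
    match r with
    | ArRel.lt => fun v => v 0 < v 1
    | ArRel.mem => fun v => v 0 ∈ Y

/-- `X ≤_ar Y` : `X` is definable without parameters in `(ℕ, +, ·, 0, 1, <, Y)`. -/
def ArReducible (X Y : Set ℕ) : Prop :=
  letI := arithStructure Y
  ∃ φ : arithLang.Formula (Fin 1), X = { n : ℕ | φ.Realize (fun _ => n) }

/-- `X` is arithmetical: definable without parameters in `(ℕ, +, ·, 0, 1, <)`. -/
def IsArithmetical (X : Set ℕ) : Prop := ArReducible X ∅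

/-- `X` and `Y` have the same arithmetic degree. -/
def ArEquiv (X Y : Set ℕ) : Prop := ArReducible X Y ∧ ArReducible Y X

/-! ## Coding conventions -/

/-- Code of a list of naturals. -/
def listCode (l : List ℕ) : ℕ := Encodable.encode l

/-- Code of a finite tuple of naturals. -/
def tupleCode {n : ℕ} (v : Fin n → ℕ) : ℕ := listCode (List.ofFn v)

/-- The subset of `ℕ` corresponding to a set of elements of a coded domain. -/
def subCode {A : Set ℕ} (S : Set ↥A) : Set ℕ := Subtype.val '' S

/-- Code of a set of `n`-tuples from a coded domain as a subset of `ℕ`. -/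
def tupleSetCode {A : Set ℕ} {n : ℕ} (X : Set (Fin n → ↥A)) : Set ℕ :=
  { c : ℕ | ∃ v ∈ X, c = tupleCode (fun i => ((v i : ℕ))) }

/-- Code of the graph of a function between coded domains. -/
def graphCode {A B : Set ℕ} (f : ↥A → ↥B) : Set ℕ :=
  { c : ℕ | ∃ a : ↥A, c = Nat.pair (a : ℕ) ((f a : ℕ)) }

/-! ## Gödel coded languages -/

/-- A fixed Gödel coding of the symbols of a countable first-order language. -/
structure GoedelCoding (L : FirstOrder.Language) where
  encFun : ∀ n, L.Functions n → ℕ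
  encFun_inj : ∀ n, Function.Injective (encFun n)
  encRel : ∀ n, L.Relations n → ℕ
  encRel_inj : ∀ n, Function.Injective (encRel n)

variable {L : FirstOrder.Language}

/-- The set of codes of the symbols of `L`. -/
def symbolCodes (g : GoedelCoding L) : Set ℕ :=
  { c | (∃ (n : ℕ) (f : L.Functions n), c = Nat.pair 0 (Nat.pair n (g.encFun n f))) ∨
        (∃ (n : ℕ) (R : L.Relations n), c = Nat.pair 1 (Nat.pair n (g.encRel n R))) }

/-- `L` is an arithmetically definable language. -/
def ArithLang (g : GoedelCoding L) : Prop := IsArithmetical (symbolCodes g)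

/-- Code of a term, with a given coding of the variables. -/
def termCode (g : GoedelCoding L) {α : Type} (encα : α → ℕ) (t : L.Term α) : ℕ :=
  listCode (t.listEncode.map (Sum.elim (fun a => Nat.pair 0 (encα a))
    (fun p => Nat.pair 1 (Nat.pair p.1 (g.encFun p.1 p.2)))))

/-- Code of a (bounded) formula, with a given coding of free variables. -/
def formulaCode (g : GoedelCoding L) {α : Type} (encα : α → ℕ) {n : ℕ}
    (φ : L.BoundedFormula α n) : ℕ :=
  listCode (φ.listEncode.map (Sum.elim
    (fun p => Nat.pair 0 (Nat.pair p.1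
      (termCode g (Sum.elim (fun a => Nat.pair 0 (encα a)) (fun i => Nat.pair 1 i.1)) p.2)))
    (Sum.elim
      (fun q => Nat.pair 1 (Nat.pair q.1 (g.encRel q.1 q.2)))
      (fun m => Nat.pair 2 m))))

/-- Code of a sentence. -/
def sentenceCode (g : GoedelCoding L) (φ : L.Sentence) : ℕ :=
  formulaCode g (fun a : Empty => a.elim) φ

/-- The set of codes of the axioms of a theory. -/
def theoryCode (g : GoedelCoding L) (T : L.Theory) : Set ℕ :=
  { c | ∃ φ ∈ T, c = sentenceCode g φ }

/-- `T` is an arithmetically definable theory. -/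
def ArithTheory (g : GoedelCoding L) (T : L.Theory) : Prop := IsArithmetical (theoryCode g T)

/-! ## Coded structures -/

/-- A coded `L`-structure: an `L`-structure whose domain is a subset of `ℕ`
with infinite complement. -/
structure CodedStructure (L : FirstOrder.Language) where
  carrier : Set ℕ
  compl_infinite : (carrierᶜ : Set ℕ).Infinite
  struc : L.Structure ↥carrier

/-- A coded structure is a model of `T`. -/
def CodedStructure.Models (M : CodedStructure L) (T : L.Theory) : Prop :=
  ∀ φ ∈ T, @Sentence.Realize L ↥M.carrier M.struc φ

/-- The (coded) elementary diagram of a coded structure. -/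
def elemDiagram (g : GoedelCoding L) (M : CodedStructure L) : Set ℕ :=
  { c | ∃ (k : ℕ) (φ : L.Formula (Fin k)) (a : Fin k → ↥M.carrier),
      c = Nat.pair (Nat.pair k (formulaCode g Fin.val φ)) (tupleCode fun i => ((a i : ℕ))) ∧
      (letI := M.struc; φ.Realize a) }

/-- A coded structure is arithmetically decidable if its elementary diagram is arithmetical. -/
def ArithDecidable (g : GoedelCoding L) (M : CodedStructure L) : Prop :=
  IsArithmetical (elemDiagram g M)

/-- `M ≼ N` for coded structures: `M`'s domain is contained in `N`'s, and the
inclusion is elementary. -/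
structure ElemSub (M N : CodedStructure L) : Prop where
  subset : M.carrier ⊆ N.carrier
  elem : ∀ (k : ℕ) (φ : L.Formula (Fin k)) (a : Fin k → ↥M.carrier),
    (letI := M.struc; φ.Realize a) ↔
      (letI := N.struc; φ.Realize (fun i => (⟨((a i : ℕ)), subset (a i).2⟩ : ↥N.carrier)))

/-- A coded model of `T` is arithmetically extendible if it is an elementary substructure of
an arithmetically decidable coded model of `T`. -/
def ArithExtendible (g : GoedelCoding L) (T : L.Theory) (M : CodedStructure L) : Prop :=
  ∃ N : CodedStructure L, ArithDecidable g N ∧ N.Models T ∧ ElemSub M N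

/-! ## Model-theoretic notions in arbitrary structures -/

/-- `N` (with structure `SN`) is a model of `T`. -/
def ModelsT (L : FirstOrder.Language) (T : L.Theory) (N : Type) (SN : L.Structure N) : Prop :=
  ∀ φ ∈ T, @Sentence.Realize L N SN φ

/-- `T` has no finite models. -/
def NoFiniteModels (L : FirstOrder.Language) (T : L.Theory) : Prop :=
  ∀ (N : Type) (SN : L.Structure N), ModelsT L T N SN → Infinite N

/-- Elementary embeddings, with the structures given explicitly. -/
def EEmb (L : FirstOrder.Language) (M : Type) (SM : L.Structure M)
    (N : Type) (SN : L.Structure N) : Type _ :=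
  @FirstOrder.Language.ElementaryEmbedding L M N SM SN

/-- The underlying map of an elementary embedding. -/
def EEmb.fn {L : FirstOrder.Language} {M : Type} {SM : L.Structure M}
    {N : Type} {SN : L.Structure N} (j : EEmb L M SM N SN) : M → N :=
  @FirstOrder.Language.ElementaryEmbedding.toFun L M N SM SN j

/-- A subset of `N^n` definable with parameters from `P`. -/
def DefinableOverT (L : FirstOrder.Language) (N : Type) (SN : L.Structure N) (P : Set N)
    {n : ℕ} (X : Set (Fin n → N)) : Prop :=
  letI := SN
  ∃ (m : ℕ) (ψ : L.Formula (Fin n ⊕ Fin m)) (b : Fin m → N),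
    (∀ i, b i ∈ P) ∧ X = { v | ψ.Realize (Sum.elim v b) }

/-- A subset of `N` definable with (arbitrary) parameters. -/
def Definable1 (L : FirstOrder.Language) (N : Type) (SN : L.Structure N) (Y : Set N) : Prop :=
  letI := SN
  ∃ (m : ℕ) (ψ : L.Formula (Fin 1 ⊕ Fin m)) (b : Fin m → N),
    Y = { x : N | ψ.Realize (Sum.elim (fun _ => x) b) }

/-- The algebraic closure of `B` in `N`: elements satisfying a formula with parameters
from `B` having finitely many solutions. -/
def aclIn (L : FirstOrder.Language) (N : Type) (SN : L.Structure N) (B : Set N) : Set N :=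
  letI := SN
  { a : N | ∃ (k : ℕ) (φ : L.Formula (Fin 1 ⊕ Fin k)) (b : Fin k → N),
      (∀ i, b i ∈ B) ∧ φ.Realize (Sum.elim (fun _ => a) b) ∧
      { x : N | φ.Realize (Sum.elim (fun _ => x) b) }.Finite }

/-- The domain of the substructure of `N` generated by `B`: values of terms at
arguments from `B`. -/
def genSub (L : FirstOrder.Language) (N : Type) (SN : L.Structure N) (B : Set N) : Set N :=
  letI := SN
  { a : N | ∃ (t : L.Term ℕ) (v : ℕ → N), (∀ i, v i ∈ B) ∧ a = t.realize v }

/-- The set defined by a formula `φ(x, p̄)` in one free variable with parameters `p̄`. -/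
def smSet (L : FirstOrder.Language) (N : Type) (SN : L.Structure N) {k : ℕ}
    (φ : L.Formula (Fin 1 ⊕ Fin k)) (p : Fin k → N) : Set N :=
  letI := SN
  { x : N | φ.Realize (Sum.elim (fun _ => x) p) }

/-- A definable tuple-set in a coded structure, with parameters from `P`. -/
def DefinableOver (M : CodedStructure L) (P : Set ↥M.carrier) {n : ℕ}
    (X : Set (Fin n → ↥M.carrier)) : Prop :=
  DefinableOverT L ↥M.carrier M.struc P X

/-- A definable tuple-set in a coded structure, with arbitrary parameters. -/
def DefinableIn (M : CodedStructure L) {n : ℕ} (X : Set (Fin n → ↥M.carrier)) : Prop :=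
  DefinableOver M Set.univ X

/-! ## Isomorphisms of coded structures and `D`-categoricity -/

/-- An isomorphism of coded `L`-structures. -/
structure CodedIso (M N : CodedStructure L) where
  toFun : ↥M.carrier → ↥N.carrier
  invFun : ↥N.carrier → ↥M.carrier
  left_inv : Function.LeftInverse invFun toFun
  right_inv : Function.RightInverse invFun toFun
  map_fun : ∀ {k : ℕ} (f : L.Functions k) (v : Fin k → ↥M.carrier),
    toFun (M.struc.funMap f v) = N.struc.funMap f (toFun ∘ v)
  map_rel : ∀ {k : ℕ} (r : L.Relations k) (v : Fin k → ↥M.carrier),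
    M.struc.RelMap r v ↔ N.struc.RelMap r (toFun ∘ v)

/-- `f` is a `D`-preserving isomorphism, where `d` is a representative of the
arithmetic degree `D`. -/
def DPreserving (d : Set ℕ) {M N : CodedStructure L} (f : CodedIso M N) : Prop :=
  ArReducible (graphCode f.toFun) d ∧
  ArReducible (graphCode f.invFun) d ∧
  (∀ (n : ℕ) (X : Set (Fin n → ↥M.carrier)), DefinableIn M X →
      ArEquiv (tupleSetCode X) d →
      ArEquiv (tupleSetCode ((fun v => f.toFun ∘ v) '' X)) d) ∧
  (∀ (n : ℕ) (Y : Set (Fin n → ↥N.carrier)), DefinableIn N Y →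
      ArEquiv (tupleSetCode Y) d →
      ArEquiv (tupleSetCode ((fun v => f.invFun ∘ v) '' Y)) d)

/-- `T` is `D`-categorical, where `d` is a representative of the nonzero
arithmetic degree `D`. -/
def DCategorical (g : GoedelCoding L) (T : L.Theory) (d : Set ℕ) : Prop :=
  ∀ M₀ M₁ M₂ : CodedStructure L,
    ArithDecidable g M₀ → M₀.Models T →
    M₁.Models T → ArithExtendible g T M₁ →
    M₂.Models T → ArithExtendible g T M₂ →
    ElemSub M₀ M₁ → ElemSub M₀ M₂ →
    ArEquiv M₁.carrier d → ArEquiv M₂.carrier d →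
    ∃ f : CodedIso M₁ M₂, DPreserving d f ∧
      ∀ (x : ℕ) (hx : x ∈ M₀.carrier) (h₁ : x ∈ M₁.carrier),
        ((f.toFun ⟨x, h₁⟩ : ℕ)) = x

/-! ## Vaughtian pairs, prime models, strong minimality -/

/-- `T` has a Vaughtian pair. -/
def HasVaughtianPair (T : L.Theory) : Prop :=
  ∃ (N : Type) (SN : L.Structure N),
    ModelsT L T N SN ∧
    ∃ S : @FirstOrder.Language.ElementarySubstructure L N SN,
      ((S.toSubstructure : Set N) ≠ Set.univ ∧
      ∃ (k : ℕ) (φ : L.Formula (Fin 1 ⊕ Fin k)) (a : Fin k → N),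
        (∀ i, a i ∈ (S.toSubstructure : Set N)) ∧
        smSet L N SN φ a ⊆ (S.toSubstructure : Set N) ∧
        (smSet L N SN φ a).Infinite)

/-- A coded model of `T` is prime: it elementarily embeds into every model of `T`. -/
def PrimeModel (L : FirstOrder.Language) (T : L.Theory) (P : CodedStructure L) : Prop :=
  P.Models T ∧ ∀ (N : Type) (SN : L.Structure N), ModelsT L T N SN →
    Nonempty (EEmb L ↥P.carrier P.struc N SN)

/-- `φ(x, p̄)` is strongly minimal over the coded model `M`: its solution set in `M` is
infinite, and in every elementary extension of `M` modelling `T` every definable subset of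
its solution set is finite or cofinite in it. -/
def StronglyMinimalOver (T : L.Theory) (M : CodedStructure L) {k : ℕ}
    (φ : L.Formula (Fin 1 ⊕ Fin k)) (p : Fin k → ↥M.carrier) : Prop :=
  (smSet L ↥M.carrier M.struc φ p).Infinite ∧
  ∀ (N : Type) (SN : L.Structure N), ModelsT L T N SN →
    ∀ j : EEmb L ↥M.carrier M.struc N SN,
      ∀ Y : Set N, Definable1 L N SN Y →
        Y ⊆ smSet L N SN φ (fun i => j.fn (p i)) →
        (Y.Finite ∨ ((smSet L N SN φ (fun i => j.fn (p i))) \ Y).Finite)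

/-- `T` is a strongly minimal theory: every model is infinite, and every
parameter-definable subset of any model is finite or cofinite. -/
def StronglyMinimalTheory (L : FirstOrder.Language) (T : L.Theory) : Prop :=
  (∀ (N : Type) (SN : L.Structure N), ModelsT L T N SN → Infinite N) ∧
  (∀ (N : Type) (SN : L.Structure N), ModelsT L T N SN →
    ∀ Y : Set N, Definable1 L N SN Y → (Y.Finite ∨ (Yᶜ : Set N).Finite))

/-- The structural control clause: an arithmetically decidable prime model together with
a strongly minimal formula over it generating every elementary extension. -/
def GeneratesAll (T : L.Theory) (P : CodedStructure L) {k : ℕ}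
    (φ : L.Formula (Fin 1 ⊕ Fin k)) (p : Fin k → ↥P.carrier) : Prop :=
  ∀ (N : Type) (SN : L.Structure N), ModelsT L T N SN →
    ∀ j : EEmb L ↥P.carrier P.struc N SN,
      aclIn L N SN (Set.range j.fn ∪ smSet L N SN φ (fun i => j.fn (p i))) = Set.univ

/-- Clause (3) of the arithmetic Baldwin–Lachlan theorem. -/
def SMControl (g : GoedelCoding L) (T : L.Theory) : Prop :=
  ∃ (P : CodedStructure L), ArithDecidable g P ∧ PrimeModel L T P ∧
    ∃ (k : ℕ) (φ : L.Formula (Fin 1 ⊕ Fin k)) (p : Fin k → ↥P.carrier),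
      StronglyMinimalOver T P φ p ∧ GeneratesAll T P φ p

/-! ## Types and arithmetical stability -/

/-- A formula with a finite parameter tuple from a coded structure, in `n` object
variables. -/
def ParamFormula (L : FirstOrder.Language) (M : CodedStructure L) (n : ℕ) : Type :=
  Σ k : ℕ, L.Formula (Fin n ⊕ Fin k) × (Fin k → ↥M.carrier)

/-- All parameters of `q` lie in `A`. -/
def paramsIn {M : CodedStructure L} {n : ℕ} (A : Set ℕ) (q : ParamFormula L M n) : Prop :=
  ∀ i, ((q.2.2 i : ℕ)) ∈ A

/-- `p` is consistent with the elementary diagram of `M`: it is realized in some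
elementary extension of `M`. -/
def TypeConsistent (M : CodedStructure L) {n : ℕ} (p : Set (ParamFormula L M n)) : Prop :=
  ∃ (N : Type) (SN : L.Structure N) (j : EEmb L ↥M.carrier M.struc N SN) (b : Fin n → N),
    ∀ q ∈ p, letI := SN; q.2.1.Realize (Sum.elim b (fun i => j.fn (q.2.2 i)))

/-- `p` is a (complete) `n`-type over `A` inside `M`: a maximal set of formulas with
parameters from `A` consistent with the elementary diagram of `M`. -/
def IsNType (M : CodedStructure L) (A : Set ℕ) (n : ℕ)
    (p : Set (ParamFormula L M n)) : Prop :=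
  (∀ q ∈ p, paramsIn A q) ∧
  TypeConsistent M p ∧
  ∀ q : ParamFormula L M n, paramsIn A q → q ∉ p → ¬ TypeConsistent M (insert q p)

/-- The code of a formula-with-parameters. -/
def pfCode (g : GoedelCoding L) {M : CodedStructure L} {n : ℕ} (q : ParamFormula L M n) : ℕ :=
  Nat.pair
    (Nat.pair q.1 (formulaCode g
      (Sum.elim (fun i : Fin n => Nat.pair 0 i.1) (fun j : Fin q.1 => Nat.pair 1 j.1)) q.2.1))
    (tupleCode fun i => ((q.2.2 i : ℕ)))

/-- The set of codes of the formulas of `p`. -/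
def typeCode (g : GoedelCoding L) {M : CodedStructure L} {n : ℕ}
    (p : Set (ParamFormula L M n)) : Set ℕ :=
  { c | ∃ q ∈ p, c = pfCode g q }

/-- `p` is realized in the coded elementary extension `N` of `M`. -/
def RealizesType {M N : CodedStructure L} (h : M.carrier ⊆ N.carrier) {n : ℕ}
    (p : Set (ParamFormula L M n)) : Prop :=
  ∃ b : Fin n → ↥N.carrier, ∀ q ∈ p,
    letI := N.struc
    q.2.1.Realize (Sum.elim b (fun i => (⟨((q.2.2 i : ℕ)), h (q.2.2 i).2⟩ : ↥N.carrier)))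

/-- The `(n, i)`-th column of an effective join. -/
def tripleSection (X : Set ℕ) (n i : ℕ) : Set ℕ := { m | Nat.pair n (Nat.pair i m) ∈ X }

/-- `T` is arithmetically stable: over every arithmetically decidable model and every
arithmetical parameter set, the family of arithmetic `n`-types (for all `n ≥ 1`) has a
uniform arithmetical code in which every arithmetic `n`-type appears at least once. -/
def ArithStable (g : GoedelCoding L) (T : L.Theory) : Prop :=
  ∀ M : CodedStructure L, ArithDecidable g M → M.Models T →
    ∀ A : Set ℕ, A ⊆ M.carrier → IsArithmetical A →
      ∃ X : Set ℕ, IsArithmetical X ∧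
        (∀ n, 1 ≤ n → ∀ i : ℕ, ∃ p : Set (ParamFormula L M n),
            IsNType M A n p ∧ IsArithmetical (typeCode g p) ∧
            tripleSection X n i = typeCode g p) ∧
        (∀ n, 1 ≤ n → ∀ p : Set (ParamFormula L M n),
            IsNType M A n p → IsArithmetical (typeCode g p) →
            ∃ i : ℕ, tripleSection X n i = typeCode g p)

/-- The set of elements occurring as a coordinate of a tuple in `X`. -/
def coordSet {N : Type} {n : ℕ} (X : Set (Fin n → N)) : Set N :=
  { m | ∃ v ∈ X, ∃ i, v i = m }


/-! ## Definability in first-order arithmetic -/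

/-- A relation on `ℕ`, with arguments indexed by `α`, that is first-order definable in the
standard model of arithmetic. -/
def Dfn {α : Type} (P : (α → ℕ) → Prop) : Prop :=
  letI := arithStructure ∅
  ∃ φ : arithLang.Formula α, ∀ v, φ.Realize v ↔ P v

/-- A function with definable graph. -/
def DfnF {α : Type} (t : (α → ℕ) → ℕ) : Prop :=
  Dfn fun w : α ⊕ Unit → ℕ => t (fun a => w (Sum.inl a)) = w (Sum.inr ())

section Dfn

variable {α β γ : Type}

theorem isArithmetical_iff_dfn {X : Set ℕ} :
    IsArithmetical X ↔ Dfn fun v : Fin 1 → ℕ => v 0 ∈ X := by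
  let _ := arithStructure ∅
  constructor
  · rintro ⟨φ, rfl⟩
    refine ⟨φ, fun v => ?_⟩
    have : (fun _ => v 0) = v := by ext i; rw [Subsingleton.elim i 0]
    simp [this]
  · rintro ⟨φ, h⟩
    exact ⟨φ, by ext n; exact (h fun _ => n).symm⟩

theorem Dfn.of_iff {P Q : (α → ℕ) → Prop} (hP : Dfn P) (h : ∀ v, Q v ↔ P v) : Dfn Q := by
  rwa [show Q = P from funext fun v => propext (h v)]

theorem Dfn.not {P : (α → ℕ) → Prop} (hP : Dfn P) : Dfn fun v => ¬ P v := by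
  let _ := arithStructure ∅
  obtain ⟨φ, h⟩ := hP
  exact ⟨φ.not, fun v => by simp [h]⟩

theorem Dfn.and {P Q : (α → ℕ) → Prop} (hP : Dfn P) (hQ : Dfn Q) : Dfn fun v => P v ∧ Q v := by
  let _ := arithStructure ∅
  obtain ⟨φ, h⟩ := hP
  obtain ⟨ψ, h'⟩ := hQ
  exact ⟨φ ⊓ ψ, fun v => by simp [h, h']⟩

theorem Dfn.or {P Q : (α → ℕ) → Prop} (hP : Dfn P) (hQ : Dfn Q) : Dfn fun v => P v ∨ Q v :=
  (hP.not.and hQ.not).not.of_iff fun v => by tauto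

theorem Dfn.imp {P Q : (α → ℕ) → Prop} (hP : Dfn P) (hQ : Dfn Q) : Dfn fun v => P v → Q v :=
  (hP.and hQ.not).not.of_iff fun v => by tauto

theorem Dfn.relabel {P : (α → ℕ) → Prop} (hP : Dfn P) (σ : α → β) :
    Dfn fun v : β → ℕ => P fun a => v (σ a) := by
  let _ := arithStructure ∅
  obtain ⟨φ, h⟩ := hP
  exact ⟨Formula.relabel σ φ, fun v => by rw [Formula.realize_relabel, h]; rfl⟩

theorem Dfn.exs [Finite γ] {P : (α → ℕ) → (γ → ℕ) → Prop}
    (hP : Dfn fun w : α ⊕ γ → ℕ => P (fun a => w (Sum.inl a)) fun c => w (Sum.inr c)) :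
    Dfn fun v => ∃ y, P v y := by
  let _ := arithStructure ∅
  obtain ⟨φ, h⟩ := hP
  exact ⟨φ.iExs γ, fun v => by simp [Formula.realize_iExs, h]⟩

theorem Dfn.ex {P : (α → ℕ) → ℕ → Prop}
    (hP : Dfn fun w : α ⊕ Unit → ℕ => P (fun a => w (Sum.inl a)) (w (Sum.inr ()))) :
    Dfn fun v => ∃ y, P v y :=
  (Dfn.exs (P := fun v (y : Unit → ℕ) => P v (y ())) hP).of_iff fun _ =>
    ⟨fun ⟨y, h⟩ => ⟨fun _ => y, h⟩, fun ⟨y, h⟩ => ⟨y (), h⟩⟩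

theorem Dfn.all {P : (α → ℕ) → ℕ → Prop}
    (hP : Dfn fun w : α ⊕ Unit → ℕ => P (fun a => w (Sum.inl a)) (w (Sum.inr ()))) :
    Dfn fun v => ∀ y, P v y :=
  (Dfn.ex (P := fun v y => ¬ P v y) hP.not).not.of_iff fun v => by simp

theorem Dfn.forall_finite [Finite γ] {P : γ → (α → ℕ) → Prop} (hP : ∀ i, Dfn (P i)) :
    Dfn fun v => ∀ i, P i v := by
  let _ := arithStructure ∅
  choose φ h using hP
  exact ⟨Formula.iInf φ, fun v => by simp [Formula.realize_iInf, h]⟩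

theorem DfnF.relabel {t : (α → ℕ) → ℕ} (ht : DfnF t) (σ : α → β) :
    DfnF fun v : β → ℕ => t fun a => v (σ a) :=
  Dfn.relabel ht (Sum.map σ id)

theorem Dfn.subst [Finite γ] {P : (γ → ℕ) → Prop} (hP : Dfn P) {t : γ → (α → ℕ) → ℕ}
    (ht : ∀ i, DfnF (t i)) : Dfn fun v => P fun i => t i v := by
  refine (Dfn.exs (P := fun v y => (∀ i, t i v = y i) ∧ P y) ?_).of_iff fun v => ?_
  · exact (Dfn.forall_finite fun i => Dfn.relabel (ht i) (Sum.map id fun _ => i)).and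
      (hP.relabel _)
  · exact ⟨fun h => ⟨_, fun _ => rfl, h⟩, fun ⟨y, hy, h⟩ => by rwa [funext hy]⟩

theorem Dfn.subst₂ {R : ℕ → ℕ → Prop} (hR : Dfn fun v : Fin 2 → ℕ => R (v 0) (v 1))
    {s t : (α → ℕ) → ℕ} (hs : DfnF s) (ht : DfnF t) : Dfn fun v => R (s v) (t v) :=
  (hR.subst (t := ![s, t]) (by simp [Fin.forall_fin_two, hs, ht])).of_iff fun _ => by simp

theorem DfnF.term (τ : arithLang.Term α) :
    letI := arithStructure ∅
    DfnF fun v => τ.realize v := by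
  let _ := arithStructure ∅
  exact ⟨Term.equal (τ.relabel Sum.inl) (Term.var (Sum.inr ())), fun v => by
    simp [Formula.realize_equal, Function.comp_def]⟩

theorem DfnF.var (a : α) : DfnF fun v => v a := DfnF.term (Term.var a)

theorem DfnF.eq {s t : (α → ℕ) → ℕ} (hs : DfnF s) (ht : DfnF t) : Dfn fun v => s v = t v := by
  let _ := arithStructure ∅
  refine Dfn.subst₂ (R := (· = ·)) ⟨Term.equal (Term.var 0) (Term.var 1), fun v => ?_⟩ hs ht
  simp [Formula.realize_equal]

theorem DfnF.lt {s t : (α → ℕ) → ℕ} (hs : DfnF s) (ht : DfnF t) : Dfn fun v => s v < t v := by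
  let _ := arithStructure ∅
  refine Dfn.subst₂ (R := (· < ·))
    ⟨Relations.formula (show arithLang.Relations 2 from ArRel.lt) ![Term.var 0, Term.var 1], fun v => ?_⟩ hs ht
  rw [Formula.realize_rel]
  rfl

theorem DfnF.of_graph {t : (α → ℕ) → ℕ} {G : (α → ℕ) → ℕ → Prop}
    (hG : Dfn fun w : α ⊕ Unit → ℕ => G (fun a => w (Sum.inl a)) (w (Sum.inr ())))
    (h : ∀ v y, t v = y ↔ G v y) : DfnF t :=
  Dfn.of_iff hG fun _ => h _ _

theorem DfnF.comp [Finite γ] {f : (γ → ℕ) → ℕ} (hf : DfnF f) {t : γ → (α → ℕ) → ℕ}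
    (ht : ∀ i, DfnF (t i)) : DfnF fun v => f fun i => t i v :=
  (Dfn.subst hf (t := fun i w => Sum.elim (fun i => t i fun a => w (Sum.inl a))
    (fun _ => w (Sum.inr ())) i) (by
      rintro (i | i)
      · exact (ht i).relabel Sum.inl
      · exact DfnF.var _)).of_iff fun _ => by simp

theorem DfnF.comp₂ {f : ℕ → ℕ → ℕ} (hf : DfnF fun v : Fin 2 → ℕ => f (v 0) (v 1))
    {s t : (α → ℕ) → ℕ} (hs : DfnF s) (ht : DfnF t) : DfnF fun v => f (s v) (t v) := by
  have := hf.comp (t := ![s, t]) (by simp [Fin.forall_fin_two, hs, ht])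
  simpa using this

theorem DfnF.comp₁ {f : ℕ → ℕ} (hf : DfnF fun v : Fin 1 → ℕ => f (v 0))
    {s : (α → ℕ) → ℕ} (hs : DfnF s) : DfnF fun v => f (s v) :=
  hf.comp (t := fun _ => s) fun _ => hs

theorem DfnF.zero : DfnF fun _ : α → ℕ => 0 :=
  DfnF.term (Term.func (l := 0) (show arithLang.Functions 0 from ArFunc.zero) ![])

theorem DfnF.one : DfnF fun _ : α → ℕ => 1 :=
  DfnF.term (Term.func (l := 0) (show arithLang.Functions 0 from ArFunc.one) ![])

theorem DfnF.add {s t : (α → ℕ) → ℕ} (hs : DfnF s) (ht : DfnF t) :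
    DfnF fun v => s v + t v :=
  DfnF.comp₂ (f := (· + ·))
    (DfnF.term (Term.func (l := 2) (show arithLang.Functions 2 from ArFunc.add) ![Term.var 0, Term.var 1])) hs ht

theorem DfnF.mul {s t : (α → ℕ) → ℕ} (hs : DfnF s) (ht : DfnF t) :
    DfnF fun v => s v * t v :=
  DfnF.comp₂ (f := (· * ·))
    (DfnF.term (Term.func (l := 2) (show arithLang.Functions 2 from ArFunc.mul) ![Term.var 0, Term.var 1])) hs ht

theorem DfnF.pair {s t : (α → ℕ) → ℕ} (hs : DfnF s) (ht : DfnF t) :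
    DfnF fun v => Nat.pair (s v) (t v) := by
  refine DfnF.comp₂ (f := Nat.pair) (DfnF.of_graph (G := fun v y =>
    (v 0 < v 1 ∧ v 1 * v 1 + v 0 = y) ∨ (¬ v 0 < v 1 ∧ v 0 * v 0 + v 0 + v 1 = y)) ?_ ?_) hs ht
  · have a := DfnF.var (Sum.inl 0 : Fin 2 ⊕ Unit)
    have b := DfnF.var (Sum.inl 1 : Fin 2 ⊕ Unit)
    have c := DfnF.var (Sum.inr () : Fin 2 ⊕ Unit)
    exact ((a.lt b).and (((b.mul b).add a).eq c)).or
      ((a.lt b).not.and ((((a.mul a).add a).add b).eq c))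
  · intro v y
    unfold Nat.pair
    split_ifs with h <;> simp [h]

theorem DfnF.fst {s : (α → ℕ) → ℕ} (hs : DfnF s) : DfnF fun v => (s v).unpair.1 := by
  refine DfnF.comp₁ (f := fun n => n.unpair.1)
    (DfnF.of_graph (G := fun v y => ∃ z, Nat.pair y z = v 0) ?_ ?_) hs
  · exact Dfn.ex (((DfnF.var (Sum.inl (Sum.inr ()))).pair (DfnF.var (Sum.inr ()))).eq
      (DfnF.var (Sum.inl (Sum.inl 0))))
  · intro v y
    constructor
    · rintro rfl
      exact ⟨(v 0).unpair.2, Nat.pair_unpair _⟩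
    · rintro ⟨z, hz⟩
      simp [← hz]

theorem DfnF.snd {s : (α → ℕ) → ℕ} (hs : DfnF s) : DfnF fun v => (s v).unpair.2 := by
  refine DfnF.comp₁ (f := fun n => n.unpair.2)
    (DfnF.of_graph (G := fun v y => ∃ z, Nat.pair z y = v 0) ?_ ?_) hs
  · exact Dfn.ex (((DfnF.var (Sum.inr ())).pair (DfnF.var (Sum.inl (Sum.inr ())))).eq
      (DfnF.var (Sum.inl (Sum.inl 0))))
  · intro v y
    constructor
    · rintro rfl
      exact ⟨(v 0).unpair.1, Nat.pair_unpair _⟩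
    · rintro ⟨z, hz⟩
      simp [← hz]

theorem DfnF.mod_succ {s t : (α → ℕ) → ℕ} (hs : DfnF s) (ht : DfnF t) :
    DfnF fun v => s v % (t v + 1) := by
  refine DfnF.comp₂ (f := fun a b => a % (b + 1)) (DfnF.of_graph (G := fun v y =>
    y < v 1 + 1 ∧ ∃ q, (v 1 + 1) * q + y = v 0) ?_ ?_) hs ht
  · exact ((DfnF.var _).lt ((DfnF.var (Sum.inl 1)).add .one)).and (Dfn.ex
      (((((DfnF.var (Sum.inl (Sum.inl 1))).add .one).mul (DfnF.var (Sum.inr ()))).add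
        (DfnF.var (Sum.inl (Sum.inr ())))).eq (DfnF.var (Sum.inl (Sum.inl 0)))))
  · intro v y
    constructor
    · rintro rfl
      exact ⟨Nat.mod_lt _ (by simp), v 0 / (v 1 + 1), Nat.div_add_mod _ _⟩
    · rintro ⟨hy, q, hq⟩
      simp only [← hq, Nat.mul_add_mod]
      exact Nat.mod_eq_of_lt hy

theorem DfnF.beta {s t : (α → ℕ) → ℕ} (hs : DfnF s) (ht : DfnF t) :
    DfnF fun v => Nat.beta (s v) (t v) :=
  hs.fst.mod_succ ((ht.add .one).mul hs.snd)

theorem exists_beta_eq (f : ℕ → ℕ) (n : ℕ) : ∃ c, ∀ i ≤ n, Nat.beta c i = f i := by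
  refine ⟨Nat.unbeta ((List.range (n + 1)).map f), fun i hi => ?_⟩
  have := Nat.beta_unbeta_coe ((List.range (n + 1)).map f) ⟨i, by simp; omega⟩
  simpa using this

theorem DfnF.rec {f g : ℕ → ℕ} (hf : DfnF fun v : Fin 1 → ℕ => f (v 0))
    (hg : DfnF fun v : Fin 1 → ℕ => g (v 0)) :
    DfnF fun v : Fin 2 → ℕ =>
      Nat.rec (motive := fun _ => ℕ) (f (v 0)) (fun y IH => g (.pair (v 0) (.pair y IH))) (v 1) := by
  refine DfnF.of_graph (G := fun v y => ∃ c, Nat.beta c 0 = f (v 0) ∧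
    (∀ i, i < v 1 → Nat.beta c (i + 1) = g (.pair (v 0) (.pair i (Nat.beta c i)))) ∧
    Nat.beta c (v 1) = y) ?_ ?_
  · refine Dfn.ex (.and ?_ (.and (Dfn.all (.imp ?_ ?_)) ?_))
    · exact ((DfnF.var _).beta .zero).eq (hf.comp₁ (.var (Sum.inl (Sum.inl 0))))
    · exact (DfnF.var _).lt (.var (Sum.inl (Sum.inl (Sum.inl 1))))
    · exact ((DfnF.var _).beta ((DfnF.var (Sum.inr ())).add .one)).eq (hg.comp₁
        ((DfnF.var (Sum.inl (Sum.inl (Sum.inl 0)))).pair ((DfnF.var _).pair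
          ((DfnF.var (Sum.inl (Sum.inr ()))).beta (DfnF.var (Sum.inr ()))))))
    · exact ((DfnF.var (Sum.inr ())).beta (.var (Sum.inl (Sum.inl 1)))).eq (.var (Sum.inl (Sum.inr ())))
  · intro v y
    constructor
    · rintro rfl
      obtain ⟨c, hc⟩ := exists_beta_eq (fun k => Nat.rec (motive := fun _ => ℕ) (f (v 0))
        (fun y IH => g (.pair (v 0) (.pair y IH))) k) (v 1)
      refine ⟨c, hc 0 (Nat.zero_le _), fun i hi => ?_, hc _ le_rfl⟩
      rw [hc _ hi, hc _ hi.le]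
    · rintro ⟨c, h0, hs, rfl⟩
      suffices h : ∀ k ≤ v 1, Nat.rec (motive := fun _ => ℕ) (f (v 0))
        (fun y IH => g (.pair (v 0) (.pair y IH))) k = Nat.beta c k from h _ le_rfl
      intro k hk
      induction k with
      | zero => exact h0.symm
      | succ k ih => rw [hs k hk, ← ih (Nat.le_of_succ_le hk)]

theorem DfnF.of_primrec {f : ℕ → ℕ} (hf : Nat.Primrec f) :
    DfnF fun v : Fin 1 → ℕ => f (v 0) := by
  induction hf with
  | zero => exact .zero
  | succ => exact (DfnF.var 0).add .one
  | left => exact (DfnF.var 0).fst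
  | right => exact (DfnF.var 0).snd
  | pair _ _ hf hg => exact hf.pair hg
  | comp _ _ hf hg => exact hf.comp₁ hg
  | @prec f g _ _ hf hg =>
    exact DfnF.comp₂ (f := fun a b => Nat.rec (motive := fun _ => ℕ) (f a)
      (fun y IH => g (.pair a (.pair y IH))) b) (DfnF.rec hf hg) (DfnF.var 0).fst (DfnF.var 0).snd

end Dfn

/-! ## Arithmetical functions and predicates on encodable types -/

open Encodable

/-- Propositions are coded by truth values. -/
noncomputable instance primcodableProp : Primcodable Prop :=
  Primcodable.ofEquiv Bool Equiv.propEquivBool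

/-- A function between primitively codable types that is induced by a definable function on
codes. Predicates are treated as functions with values in `Prop`. -/
@[fun_prop]
def ArF {α β : Type} [Primcodable α] [Primcodable β] (f : α → β) : Prop :=
  ∃ F : ℕ → ℕ, (DfnF fun v : Fin 1 → ℕ => F (v 0)) ∧ ∀ a, F (encode a) = encode (f a)

section ArF

variable {α β γ δ : Type} [Primcodable α] [Primcodable β] [Primcodable γ] [Primcodable δ]

open Classical in
theorem encode_prop (p : Prop) : encode p = if p then 1 else 0 := by
  change encode (Equiv.propEquivBool p) = _
  by_cases h : p <;> simp [h, Equiv.propEquivBool]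

theorem encode_prop_eq_one {p : Prop} : encode p = 1 ↔ p := by
  classical
  rw [encode_prop]
  split_ifs <;> simp_all

open Classical in
theorem DfnF.ite {ι : Type} {P : (ι → ℕ) → Prop} {s t : (ι → ℕ) → ℕ} (hP : Dfn P) (hs : DfnF s)
    (ht : DfnF t) : DfnF fun v => if P v then s v else t v := by
  refine DfnF.of_graph (G := fun v y => (P v ∧ s v = y) ∨ (¬ P v ∧ t v = y)) ?_ ?_
  · exact ((hP.relabel _).and ((hs.relabel _).eq (.var _))).or
      ((hP.relabel _).not.and ((ht.relabel _).eq (.var _)))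
  · intro v y
    by_cases h : P v <;> simp [h]

theorem ArF.of_primrec {f : α → β} (hf : Primrec f) : ArF f := by
  refine ⟨fun n => Nat.pred (encode ((decode n : Option α).map f)), ?_, fun a => by simp⟩
  exact DfnF.of_primrec (Nat.Primrec.pred.comp hf)

@[fun_prop]
theorem ArF.id : ArF fun a : α => a := .of_primrec .id

@[fun_prop]
theorem ArF.const (b : β) : ArF fun _ : α => b := .of_primrec (.const b)

@[fun_prop]
theorem ArF.comp {f : β → γ} {g : α → β} (hf : ArF f) (hg : ArF g) : ArF fun a => f (g a) := by
  obtain ⟨F, hF, h⟩ := hf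
  obtain ⟨G, hG, h'⟩ := hg
  exact ⟨fun n => F (G n), hF.comp₁ hG, fun a => by dsimp only; rw [h', h]⟩

@[fun_prop]
theorem ArF.pair {f : α → β} {g : α → γ} (hf : ArF f) (hg : ArF g) :
    ArF fun a => (f a, g a) := by
  obtain ⟨F, hF, h⟩ := hf
  obtain ⟨G, hG, h'⟩ := hg
  exact ⟨fun n => Nat.pair (F n) (G n), hF.pair hG, fun a => by dsimp only; rw [h', h]; rfl⟩

@[fun_prop]
theorem ArF.fst {f : α → β × γ} (hf : ArF f) : ArF fun a => (f a).1 :=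
  .comp (.of_primrec .fst) hf

@[fun_prop]
theorem ArF.snd {f : α → β × γ} (hf : ArF f) : ArF fun a => (f a).2 :=
  .comp (.of_primrec .snd) hf

theorem ArF.comp₂ {f : β → γ → δ} (hf : ArF fun p : β × γ => f p.1 p.2) {g : α → β} {h : α → γ}
    (hg : ArF g) (hh : ArF h) : ArF fun a => f (g a) (h a) :=
  .comp hf (.pair hg hh)

theorem ArF.of_primrec₂ {f : β → γ → δ} (hf : Primrec₂ f) {g : α → β} {h : α → γ}
    (hg : ArF g) (hh : ArF h) : ArF fun a => f (g a) (h a) :=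
  .comp₂ (.of_primrec hf) hg hh

open Classical in
theorem arF_iff_dfn {P : α → Prop} : ArF P ↔
    ∃ Q : ℕ → Prop, (Dfn fun v : Fin 1 → ℕ => Q (v 0)) ∧ ∀ a, P a ↔ Q (encode a) := by
  constructor
  · rintro ⟨F, hF, h⟩
    exact ⟨fun n => F n = 1, hF.eq .one, fun a => by dsimp only; rw [h, encode_prop_eq_one]⟩
  · rintro ⟨Q, hQ, h⟩
    exact ⟨fun n => if Q n then 1 else 0, .ite hQ .one .zero, fun a => by
      rw [encode_prop]; simp [h]⟩

theorem isArithmetical_iff_arF {X : Set ℕ} : IsArithmetical X ↔ ArF fun n => n ∈ X := by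
  rw [isArithmetical_iff_dfn, arF_iff_dfn]
  constructor
  · exact fun h => ⟨_, h, fun _ => Iff.rfl⟩
  · rintro ⟨Q, hQ, h⟩
    exact hQ.of_iff fun v => h _

theorem ArF.of_primrecPred {P : α → Prop} (hP : PrimrecPred P) : ArF P := by
  obtain ⟨_, hP⟩ := hP
  obtain ⟨F, hF, h⟩ := ArF.of_primrec hP
  refine arF_iff_dfn.2 ⟨fun n => F n = 1, hF.eq .one, fun a => ?_⟩
  dsimp only
  rw [h]
  by_cases hP : P a <;> simp [hP]

theorem ArF.of_primrecRel {R : β → γ → Prop} (hR : PrimrecRel R) {g : α → β} {h : α → γ}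
    (hg : ArF g) (hh : ArF h) : ArF fun a => R (g a) (h a) :=
  .comp₂ (.of_primrecPred hR) hg hh

@[fun_prop]
theorem ArF.not {P : α → Prop} (hP : ArF P) : ArF fun a => ¬ P a := by
  obtain ⟨Q, hQ, h⟩ := arF_iff_dfn.1 hP
  exact arF_iff_dfn.2 ⟨fun n => ¬ Q n, hQ.not, fun a => by rw [h]⟩

@[fun_prop]
theorem ArF.and {P Q : α → Prop} (hP : ArF P) (hQ : ArF Q) : ArF fun a => P a ∧ Q a := by
  obtain ⟨P', hP', h⟩ := arF_iff_dfn.1 hP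
  obtain ⟨Q', hQ', h'⟩ := arF_iff_dfn.1 hQ
  exact arF_iff_dfn.2 ⟨fun n => P' n ∧ Q' n, hP'.and hQ', fun a => by rw [h, h']⟩

theorem ArF.of_iff {P Q : α → Prop} (hP : ArF P) (h : ∀ v, Q v ↔ P v) : ArF Q := by
  rwa [show Q = P from funext fun v => propext (h v)]

@[fun_prop]
theorem ArF.or {P Q : α → Prop} (hP : ArF P) (hQ : ArF Q) : ArF fun a => P a ∨ Q a :=
  (hP.not.and hQ.not).not.of_iff fun v => by tauto

@[fun_prop]
theorem ArF.imp {P Q : α → Prop} (hP : ArF P) (hQ : ArF Q) : ArF fun a => P a → Q a :=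
  (hP.and hQ.not).not.of_iff fun v => by tauto

@[fun_prop]
theorem ArF.iff {P Q : α → Prop} (hP : ArF P) (hQ : ArF Q) : ArF fun a => P a ↔ Q a :=
  ((hP.imp hQ).and (hQ.imp hP)).of_iff fun v => by tauto

@[fun_prop]
theorem ArF.ex {P : α → β → Prop} (hP : ArF fun p : α × β => P p.1 p.2) :
    ArF fun a => ∃ b, P a b := by
  obtain ⟨Q, hQ, h⟩ := arF_iff_dfn.1 hP
  obtain ⟨R, hR, h'⟩ := arF_iff_dfn.1 (ArF.of_primrecPred (Primcodable.mem_range_encode (α := β)))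
  refine arF_iff_dfn.2 ⟨fun n => ∃ m, R m ∧ Q (Nat.pair n m), ?_, fun a => ?_⟩
  · refine Dfn.ex (.and (hR.subst (t := fun _ w => w (Sum.inr ())) fun _ => .var _)
      (hQ.subst (t := fun _ w => Nat.pair (w (Sum.inl 0)) (w (Sum.inr ()))) fun _ => ?_))
    exact (DfnF.var _).pair (.var _)
  · constructor
    · rintro ⟨b, hb⟩
      exact ⟨encode b, (h' _).1 ⟨b, rfl⟩, (h (a, b)).1 hb⟩
    · rintro ⟨m, hm, hb⟩
      obtain ⟨b, rfl⟩ := (h' _).2 hm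
      exact ⟨b, (h (a, b)).2 hb⟩

@[fun_prop]
theorem ArF.all {P : α → β → Prop} (hP : ArF fun p : α × β => P p.1 p.2) :
    ArF fun a => ∀ b, P a b :=
  (ArF.ex (P := fun a b => ¬ P a b) hP.not).not.of_iff fun v => by simp

@[fun_prop]
theorem ArF.eq {f g : α → β} (hf : ArF f) (hg : ArF g) : ArF fun a => f a = g a :=
  .of_primrecRel Primrec.eq hf hg

@[fun_prop]
theorem ArF.lt {f g : α → ℕ} (hf : ArF f) (hg : ArF g) : ArF fun a => f a < g a :=
  .of_primrecRel Primrec.nat_lt hf hg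

@[fun_prop]
theorem ArF.le {f g : α → ℕ} (hf : ArF f) (hg : ArF g) : ArF fun a => f a ≤ g a :=
  .of_primrecRel Primrec.nat_le hf hg

open Classical in
/-- A function with arithmetical graph is arithmetical. -/
theorem ArF.of_graph {f : α → β} (hG : ArF fun p : α × β => f p.1 = p.2) : ArF f := by
  obtain ⟨Q, hQ, h⟩ := arF_iff_dfn.1 hG
  obtain ⟨R, hR, h'⟩ := arF_iff_dfn.1 (ArF.of_primrecPred (Primcodable.mem_range_encode (α := α)))
  obtain ⟨S, hS, h''⟩ := arF_iff_dfn.1 (ArF.of_primrecPred (Primcodable.mem_range_encode (α := β)))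
  let F : ℕ → ℕ := fun n => if h : ∃ a : α, encode a = n then encode (f h.choose) else 0
  have hF : ∀ a, F (encode a) = encode (f a) := fun a => by
    have : ∃ b : α, encode b = encode a := ⟨a, rfl⟩
    simp only [F, dif_pos this]
    rw [encode_injective this.choose_spec]
  refine ⟨F, DfnF.of_graph (G := fun v m => (¬ R (v 0) ∧ m = 0) ∨
    (R (v 0) ∧ S m ∧ Q (Nat.pair (v 0) m))) ?_ ?_, hF⟩
  · refine .or (.and (.not ?_) ?_) (.and ?_ (.and ?_ ?_))
    · exact hR.subst (t := fun _ w => w (Sum.inl 0)) fun _ => .var _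
    · exact (DfnF.var _).eq .zero
    · exact hR.subst (t := fun _ w => w (Sum.inl 0)) fun _ => .var _
    · exact hS.subst (t := fun _ w => w (Sum.inr ())) fun _ => .var _
    · exact hQ.subst (t := fun _ w => Nat.pair (w (Sum.inl 0)) (w (Sum.inr ()))) fun _ =>
        (DfnF.var _).pair (.var _)
  · intro v m
    by_cases hv : R (v 0)
    · obtain ⟨a, ha⟩ := (h' _).2 hv
      have hR' : R (Encodable.encode a) := by rwa [ha]
      simp only [← ha, hR', not_true_eq_false, false_and, true_and, false_or, hF]
      constructor
      · rintro rfl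
        exact ⟨(h'' _).1 ⟨_, rfl⟩, (h (a, f a)).1 rfl⟩
      · rintro ⟨hm, hq⟩
        obtain ⟨b, rfl⟩ := (h'' _).2 hm
        rw [(h (a, b)).2 hq]
    · have : ¬ ∃ a : α, encode a = v 0 := fun ha => hv ((h' _).1 ha)
      simp [hv, F, this, eq_comm]

theorem ArF.of_graph_iff {f : α → β} {G : α → β → Prop} (hG : ArF fun p : α × β => G p.1 p.2)
    (h : ∀ a b, f a = b ↔ G a b) : ArF f :=
  .of_graph (hG.of_iff fun p => h p.1 p.2)

@[fun_prop]
theorem ArF.ite {P : α → Prop} [DecidablePred P] {f g : α → β} (hP : ArF P) (hf : ArF f)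
    (hg : ArF g) : ArF fun a => if P a then f a else g a := by
  refine .of_graph_iff (G := fun a b => (P a ∧ f a = b) ∨ (¬ P a ∧ g a = b)) ?_ ?_
  · fun_prop
  · intro a b
    by_cases h : P a <;> simp [h]

@[fun_prop]
theorem ArF.natAdd {f g : α → ℕ} (hf : ArF f) (hg : ArF g) : ArF fun a => f a + g a :=
  .of_primrec₂ Primrec.nat_add hf hg

@[fun_prop]
theorem ArF.natSub {f g : α → ℕ} (hf : ArF f) (hg : ArF g) : ArF fun a => f a - g a :=
  .of_primrec₂ Primrec.nat_sub hf hg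

@[fun_prop]
theorem ArF.natMul {f g : α → ℕ} (hf : ArF f) (hg : ArF g) : ArF fun a => f a * g a :=
  .of_primrec₂ Primrec.nat_mul hf hg

@[fun_prop]
theorem ArF.natPair {f g : α → ℕ} (hf : ArF f) (hg : ArF g) : ArF fun a => Nat.pair (f a) (g a) :=
  .of_primrec₂ Primrec₂.natPair hf hg

@[fun_prop]
theorem ArF.natUnpair {f : α → ℕ} (hf : ArF f) : ArF fun a => Nat.unpair (f a) :=
  .comp (.of_primrec .unpair) hf

@[fun_prop]
theorem ArF.encode {f : α → β} (hf : ArF f) : ArF fun a => encode (f a) :=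
  .comp (.of_primrec .encode) hf

@[fun_prop]
theorem ArF.listLength {f : α → List β} (hf : ArF f) : ArF fun a => (f a).length :=
  .comp (.of_primrec .list_length) hf

@[fun_prop]
theorem ArF.listRange {f : α → ℕ} (hf : ArF f) : ArF fun a => List.range (f a) :=
  .comp (.of_primrec .list_range) hf

@[fun_prop]
theorem ArF.listAppend {f g : α → List β} (hf : ArF f) (hg : ArF g) : ArF fun a => f a ++ g a :=
  .of_primrec₂ Primrec.list_append hf hg

@[fun_prop]
theorem ArF.listCons {f : α → β} {g : α → List β} (hf : ArF f) (hg : ArF g) :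
    ArF fun a => f a :: g a :=
  .of_primrec₂ Primrec.list_cons hf hg

@[fun_prop]
theorem ArF.listTake {f : α → ℕ} {g : α → List β} (hf : ArF f) (hg : ArF g) :
    ArF fun a => (g a).take (f a) :=
  .of_primrec₂ Primrec.list_take hf hg

@[fun_prop]
theorem ArF.listGetD {f : α → List β} {g : α → ℕ} (hf : ArF f) (hg : ArF g) (d : β) :
    ArF fun a => (f a).getD (g a) d :=
  .of_primrec₂ (Primrec.list_getD d) hf hg

@[fun_prop]
theorem ArF.getElem? {f : α → List β} {g : α → ℕ} (hf : ArF f) (hg : ArF g) :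
    ArF fun a => (f a)[g a]? :=
  .of_primrec₂ Primrec.list_getElem? hf hg

@[fun_prop]
theorem ArF.some {f : α → β} (hf : ArF f) : ArF fun a => Option.some (f a) :=
  .comp (.of_primrec .option_some) hf

/-- Decode a number, with a default value. -/
def decodeD (β : Type) [Primcodable β] [Inhabited β] (n : ℕ) : β := (decode n).getD default

@[simp]
theorem decodeD_encode [Inhabited β] (b : β) : decodeD β (Encodable.encode b) = b := by
  simp [decodeD]

@[fun_prop]
theorem ArF.decodeD [Inhabited β] {f : α → ℕ} (hf : ArF f) : ArF fun a => decodeD β (f a) :=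
  .comp (.of_primrec (Primrec.option_getD_default.comp .decode)) hf

@[fun_prop]
theorem ArF.listMem {f : α → β} {g : α → List β} (hf : ArF f) (hg : ArF g) :
    ArF fun a => f a ∈ g a := by
  have : ArF fun a => ∃ i : ℕ, (g a)[i]? = Option.some (f a) := by fun_prop
  exact this.of_iff fun a => by rw [List.mem_iff_getElem?]

@[fun_prop]
theorem ArF.listMap {f : α → List β} {g : α → β → γ} (hf : ArF f)
    (hg : ArF fun p : α × β => g p.1 p.2) : ArF fun a => (f a).map (g a) := by
  have h1 : ∀ a (l : List γ), (f a).map (g a) = l ↔ (f a).length = l.length ∧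
      ∀ (i : ℕ) b c, (f a)[i]? = Option.some b → l[i]? = Option.some c → g a b = c := by
    intro a l
    constructor
    · rintro rfl
      refine ⟨by simp, fun i b c hb hc => ?_⟩
      simpa [hb] using hc
    · rintro ⟨hl, h⟩
      refine List.ext_getElem (by simpa using hl) fun i hi hi' => ?_
      rw [List.getElem_map]
      exact h i _ _ (List.getElem?_eq_getElem _) (List.getElem?_eq_getElem _)
  refine .of_graph_iff ?_ h1
  refine .and (by fun_prop) (.all (.all (.all (.imp (by fun_prop) (.imp (by fun_prop) ?_)))))
  exact .eq (.comp₂ hg (by fun_prop) (by fun_prop)) (by fun_prop)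

/-- Course-of-values recursion preserves arithmeticity. -/
theorem ArF.strongRec {G : α → List β → β} (hG : ArF fun p : α × List β => G p.1 p.2)
    {f : α → ℕ → β} (h : ∀ a e, f a e = G a ((List.range e).map (f a))) :
    ArF fun p : α × ℕ => f p.1 p.2 := by
  have key : ∀ (p : α × ℕ) (b : β), f p.1 p.2 = b ↔ ∃ l : List β,
      (∀ j, j ≤ p.2 → l[j]? = Option.some (G p.1 (l.take j))) ∧ l[p.2]? = Option.some b := by
    rintro ⟨a, e⟩ b
    constructor
    · rintro rfl
      refine ⟨(List.range (e + 1)).map (f a), fun j hj => ?_, ?_⟩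
      · rw [← List.map_take, List.take_range, min_eq_left (by omega), ← h]
        simp [show j < e + 1 by omega]
      · simp
    · rintro ⟨l, hl, hb⟩
      have hb' : e < l.length := (List.getElem?_eq_some_iff.1 hb).1
      have : ∀ j ≤ e, l.take j = (List.range j).map (f a) ∧ l[j]? = Option.some (f a j) := by
        intro j hj
        induction j with
        | zero =>
          have := hl 0 (Nat.zero_le _)
          simp only [List.take_zero] at this ⊢
          rw [this, h]
          simp
        | succ j ih =>
          obtain ⟨h1, h2⟩ := ih (by omega)
          have h3 : l.take (j + 1) = (List.range (j + 1)).map (f a) := by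
            rw [List.take_add_one, h1, h2, List.range_succ]
            simp
          refine ⟨h3, ?_⟩
          rw [hl _ hj, h3, ← h]
      exact Option.some_injective _ ((this e le_rfl).2.symm.trans hb)
  refine .of_graph_iff ?_ key
  refine .ex (.and (.all (.imp (by fun_prop) (.eq (by fun_prop) (.some ?_)))) (by fun_prop))
  exact .comp₂ hG (by fun_prop) (by fun_prop)

end ArF

/-! ## Codes of formulas -/

section Codes

theorem listCode_injective : Function.Injective listCode := Encodable.encode_injective

@[simp]
theorem decodeD_listCode (l : List ℕ) : decodeD (List ℕ) (listCode l) = l := decodeD_encode l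

theorem tupleCode_injective {n : ℕ} : Function.Injective (tupleCode (n := n)) :=
  listCode_injective.comp List.ofFn_injective

variable (g : GoedelCoding L)

theorem termCode_injective {α : Type} {encα : α → ℕ} (h : Function.Injective encα) :
    Function.Injective (termCode g encα) := by
  refine listCode_injective.comp ((List.map_injective_iff.2 ?_).comp Term.listEncode_injective)
  rintro (a | ⟨m, f⟩) (b | ⟨m', f'⟩) hab
  · simp only [Sum.elim_inl, Nat.pair_eq_pair, true_and] at hab
    rw [h hab]
  · simp at hab
  · simp at hab
  · simp only [Sum.elim_inr, Nat.pair_eq_pair, true_and] at hab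
    obtain ⟨rfl, hab⟩ := hab
    rw [g.encFun_inj _ hab]

theorem formulaCode_injective {α : Type} {encα : α → ℕ} (h : Function.Injective encα) (n : ℕ) :
    Function.Injective (formulaCode g encα (n := n)) := by
  intro φ ψ hφ
  have hinj : Function.Injective (Sum.elim
    (fun p : Σ k, L.Term (α ⊕ Fin k) => Nat.pair 0 (Nat.pair p.1
      (termCode g (Sum.elim (fun a => Nat.pair 0 (encα a)) (fun i => Nat.pair 1 i.1)) p.2)))
    (Sum.elim
      (fun q : Σ n, L.Relations n => Nat.pair 1 (Nat.pair q.1 (g.encRel q.1 q.2)))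
      (fun m => Nat.pair 2 m))) := by
    rintro (⟨k, t⟩ | ⟨k, R⟩ | m) (⟨k', t'⟩ | ⟨k', R'⟩ | m') hab <;>
      simp only [Sum.elim_inl, Sum.elim_inr, Nat.pair_eq_pair, true_and, OfNat.ofNat_ne_one,
        zero_ne_one, one_ne_zero, OfNat.ofNat_ne_zero, OfNat.one_ne_ofNat, OfNat.zero_ne_ofNat,
        false_and] at hab
    · obtain ⟨rfl, hab⟩ := hab
      rw [termCode_injective g ?_ hab]
      rintro (a | i) (b | j) hab <;> simp [Nat.pair_eq_pair] at hab
      · rw [h hab]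
      · rw [Fin.ext hab]
    · obtain ⟨rfl, hab⟩ := hab
      rw [g.encRel_inj _ hab]
    · rw [hab]
  have := BoundedFormula.listEncode_sigma_injective (a₁ := ⟨n, φ⟩) (a₂ := ⟨n, ψ⟩)
    (List.map_injective_iff.2 hinj (listCode_injective hφ))
  simpa using this

/-- Renaming of the free variables, without changing the bound variables. -/
def rename {α β : Type} (σ : α → β) {n : ℕ} (φ : L.BoundedFormula α n) : L.BoundedFormula β n :=
  φ.mapTermRel (fun _ t => t.relabel (Sum.map σ id)) (fun _ => id) fun _ => id

theorem realize_rename {α β : Type} (σ : α → β) {n : ℕ} (φ : L.BoundedFormula α n)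
    {M : Type*} [L.Structure M] (v : β → M) (xs : Fin n → M) :
    (rename σ φ).Realize v xs ↔ φ.Realize (fun a => v (σ a)) xs := by
  refine BoundedFormula.realize_mapTermRel_id (fun n t xs => ?_) fun _ _ _ => rfl
  rw [Term.realize_relabel]
  congr 1
  ext (i | i) <;> rfl

theorem realize_rename_formula {α β : Type} (σ : α → β) (φ : L.Formula α)
    {M : Type*} [L.Structure M] (v : β → M) :
    Formula.Realize (rename σ φ : L.Formula β) v ↔ φ.Realize fun a => v (σ a) :=
  realize_rename σ φ v _

theorem listEncode_term_relabel {α β : Type} (σ : α → β) (t : L.Term α) :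
    (t.relabel σ).listEncode = t.listEncode.map (Sum.map σ id) := by
  induction t with
  | var => rfl
  | func f ts ih => simp [Term.relabel, Term.listEncode, ih, List.map_flatMap]

theorem termCode_relabel {α β : Type} (σ : α → β) (encβ : β → ℕ) (t : L.Term α) :
    termCode g encβ (t.relabel σ) = termCode g (fun a => encβ (σ a)) t := by
  unfold termCode
  rw [listEncode_term_relabel, List.map_map]
  congr 2
  ext (a | p) <;> rfl

theorem listEncode_rename {α β : Type} (σ : α → β) {n : ℕ} (φ : L.BoundedFormula α n) :
    (rename σ φ).listEncode = φ.listEncode.map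
      (Sum.map (fun p => ⟨p.1, p.2.relabel (Sum.map σ id)⟩) id) := by
  unfold rename
  induction φ with
  | falsum => rfl
  | equal => rfl
  | rel => simp [BoundedFormula.mapTermRel, BoundedFormula.listEncode]
  | imp _ _ h h' => simp [BoundedFormula.mapTermRel, BoundedFormula.listEncode, h, h']
  | all _ h => simp [BoundedFormula.mapTermRel, BoundedFormula.listEncode, h]

theorem formulaCode_rename {α β : Type} (σ : α → β) (encβ : β → ℕ) {n : ℕ}
    (φ : L.BoundedFormula α n) :
    formulaCode g encβ (rename σ φ) = formulaCode g (fun a => encβ (σ a)) φ := by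
  unfold formulaCode
  rw [listEncode_rename, List.map_map]
  congr 2
  ext (⟨k, t⟩ | p)
  · simp only [Function.comp_apply, Sum.map_inl, Sum.elim_inl, termCode_relabel]
    congr
    ext (a | i) <;> rfl
  · rfl

/-- The effect on codes of terms of changing the coding of the free variables by `h`. -/
def recodeTerm (h : ℕ → ℕ) (c : ℕ) : ℕ :=
  listCode ((decodeD (List ℕ) c).map fun s =>
    if s.unpair.1 = 0 ∧ s.unpair.2.unpair.1 = 0 then
      Nat.pair 0 (Nat.pair 0 (h s.unpair.2.unpair.2)) else s)

/-- The effect on codes of formulas of changing the coding of the free variables by `h`. -/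
def recode (h : ℕ → ℕ) (c : ℕ) : ℕ :=
  listCode ((decodeD (List ℕ) c).map fun s =>
    if s.unpair.1 = 0 then
      Nat.pair 0 (Nat.pair s.unpair.2.unpair.1 (recodeTerm h s.unpair.2.unpair.2)) else s)

theorem recodeTerm_termCode {α : Type} (h : ℕ → ℕ) (encα : α → ℕ) {k : ℕ}
    (t : L.Term (α ⊕ Fin k)) :
    recodeTerm h
      (termCode g (Sum.elim (fun a => Nat.pair 0 (encα a)) (fun i => Nat.pair 1 i.1)) t) =
    termCode g (Sum.elim (fun a => Nat.pair 0 (h (encα a))) (fun i => Nat.pair 1 i.1)) t := by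
  unfold recodeTerm termCode
  rw [decodeD_listCode, List.map_map]
  congr 2
  ext ((a | i) | p) <;> simp

theorem recode_formulaCode {α : Type} (h : ℕ → ℕ) (encα : α → ℕ) {n : ℕ}
    (φ : L.BoundedFormula α n) :
    recode h (formulaCode g encα φ) = formulaCode g (fun a => h (encα a)) φ := by
  unfold recode formulaCode
  rw [decodeD_listCode, List.map_map]
  congr 2
  ext (p | q | m) <;> simp [recodeTerm_termCode]

variable {α : Type} [Primcodable α]

@[fun_prop]
theorem ArF.listCode {f : α → List ℕ} (hf : ArF f) : ArF fun a => listCode (f a) :=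
  .encode hf

theorem ArF.recode {h : ℕ → ℕ} (hh : ArF h) {f : α → ℕ} (hf : ArF f) :
    ArF fun a => recode h (f a) := by
  have h1 : ArF (recodeTerm h) := by
    unfold recodeTerm
    fun_prop
  refine .comp (f := ArMorley.recode h) ?_ hf
  unfold ArMorley.recode
  fun_prop

end Codes

/-! ## The elementary diagram -/

section ElemDiagram

variable (g : GoedelCoding L) (M : CodedStructure L)

instance CodedStructure.instStructure : L.Structure ↥M.carrier := M.struc

theorem mem_elemDiagram_iff {k : ℕ} {φ : L.Formula (Fin k)} {a : Fin k → ↥M.carrier} :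
    Nat.pair (Nat.pair k (formulaCode g Fin.val φ)) (tupleCode fun i => (a i : ℕ)) ∈
      elemDiagram g M ↔ φ.Realize a := by
  constructor
  · rintro ⟨k', φ', a', h, h'⟩
    simp only [Nat.pair_eq_pair] at h
    obtain ⟨⟨rfl, h1⟩, h2⟩ := h
    obtain rfl := formulaCode_injective g Fin.val_injective 0 h1
    have : a = a' := by
      ext i
      exact congrFun (tupleCode_injective h2) i
    rw [this]
    exact h'
  · exact fun h => ⟨k, φ, a, rfl, h⟩

/-- The codes of formulas in the variables `0, …, k - 1`, paired with `k`. -/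
def formulaIndex {k : ℕ} (φ : L.Formula (Fin k)) : ℕ := Nat.pair k (formulaCode g Fin.val φ)

theorem pair_mem_elemDiagram_iff {k : ℕ} {φ : L.Formula (Fin k)} {l : List ℕ} :
    Nat.pair (formulaIndex g φ) (listCode l) ∈ elemDiagram g M ↔
      ∃ a : Fin k → ↥M.carrier, l = List.ofFn (fun i => (a i : ℕ)) ∧ φ.Realize a := by
  constructor
  · intro h
    have h0 := h
    obtain ⟨k', φ', a', h, h'⟩ := h
    simp only [formulaIndex, Nat.pair_eq_pair] at h
    obtain ⟨⟨rfl, h1⟩, h2⟩ := h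
    obtain rfl := listCode_injective h2
    exact ⟨a', rfl, (mem_elemDiagram_iff g M).1 h0⟩
  · rintro ⟨a, rfl, h⟩
    exact (mem_elemDiagram_iff g M).2 h

end ElemDiagram

/-! ## Formulas with parameters -/

section ParamFormulas

variable {n k : ℕ}

/-- Merge the object variables and the parameter variables of a formula. -/
def joinFormula (φ : L.Formula (Fin n ⊕ Fin k)) : L.Formula (Fin (n + k)) :=
  rename finSumFinEquiv φ

/-- The coding of the variables of a formula with parameters. -/
def sumVarCode (n k : ℕ) : Fin n ⊕ Fin k → ℕ :=
  Sum.elim (fun i : Fin n => Nat.pair 0 i.1) (fun j : Fin k => Nat.pair 1 j.1)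

/-- The code of the variable of a formula with parameters from its merged code. -/
def splitVar (n i : ℕ) : ℕ := if i < n then Nat.pair 0 i else Nat.pair 1 (i - n)

/-- The merged code of a variable of a formula with parameters. -/
def joinVar (n c : ℕ) : ℕ := if c.unpair.1 = 0 then c.unpair.2 else n + c.unpair.2

theorem arF_splitVar (n : ℕ) : ArF (splitVar n) := by
  unfold splitVar
  fun_prop

theorem arF_joinVar (n : ℕ) : ArF (joinVar n) := by
  unfold joinVar
  fun_prop

theorem splitVar_finSumFinEquiv (s : Fin n ⊕ Fin k) :
    splitVar n (finSumFinEquiv s).val = sumVarCode n k s := by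
  rcases s with i | i <;> simp [splitVar, sumVarCode]

theorem joinVar_sumVarCode (s : Fin n ⊕ Fin k) :
    joinVar n (sumVarCode n k s) = (finSumFinEquiv s).val := by
  rcases s with i | i <;> simp [joinVar, sumVarCode]

variable (g : GoedelCoding L)

theorem recode_splitVar (φ : L.Formula (Fin n ⊕ Fin k)) :
    recode (splitVar n) (formulaCode g Fin.val (joinFormula φ)) =
      formulaCode g (sumVarCode n k) φ := by
  rw [recode_formulaCode, joinFormula, formulaCode_rename]
  simp only [splitVar_finSumFinEquiv]

theorem recode_joinVar (φ : L.Formula (Fin n ⊕ Fin k)) :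
    recode (joinVar n) (formulaCode g (sumVarCode n k) φ) =
      formulaCode g Fin.val (joinFormula φ) := by
  rw [recode_formulaCode, joinFormula, formulaCode_rename]
  simp only [joinVar_sumVarCode]

theorem realize_joinFormula {N : Type*} [L.Structure N] (φ : L.Formula (Fin n ⊕ Fin k))
    (v : Fin n → N) (w : Fin k → N) :
    (joinFormula φ).Realize (Fin.append v w) ↔ φ.Realize (Sum.elim v w) := by
  rw [joinFormula, realize_rename_formula]
  congr!
  rename_i s
  rcases s with i | i <;> simp

theorem exists_joinFormula_eq (ψ : L.Formula (Fin (n + k))) :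
    ∃ φ : L.Formula (Fin n ⊕ Fin k), formulaCode g Fin.val (joinFormula φ) =
      formulaCode g Fin.val ψ :=
  ⟨rename finSumFinEquiv.symm ψ, by simp [joinFormula, formulaCode_rename]⟩

theorem pfCode_eq {M : CodedStructure L} (q : ParamFormula L M n) :
    pfCode g q = Nat.pair (Nat.pair q.1 (formulaCode g (sumVarCode n q.1) q.2.1))
      (listCode (List.ofFn fun i => (q.2.2 i : ℕ))) := rfl

theorem mem_elemDiagram_joinFormula_iff {N : CodedStructure L} {φ : L.Formula (Fin n ⊕ Fin k)}
    {v : Fin n → ↥N.carrier} {l : List ℕ} :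
    Nat.pair (Nat.pair (n + k) (formulaCode g Fin.val (joinFormula φ)))
        (listCode (List.ofFn (fun i => (v i : ℕ)) ++ l)) ∈ elemDiagram g N ↔
      ∃ w : Fin k → ↥N.carrier, l = List.ofFn (fun i => (w i : ℕ)) ∧
        φ.Realize (Sum.elim v w) := by
  constructor
  · intro h
    obtain ⟨a, ha, h⟩ := (pair_mem_elemDiagram_iff g N).1 h
    have e : a = Fin.append (fun i => a (Fin.castAdd k i)) (fun i => a (Fin.natAdd n i)) :=
      (Fin.append_castAdd_natAdd).symm
    have : List.ofFn (fun i => (a i : ℕ)) = List.ofFn (fun i => (a (Fin.castAdd k i) : ℕ)) ++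
        List.ofFn (fun i => (a (Fin.natAdd n i) : ℕ)) := by
      rw [← List.ofFn_fin_append]
      congr 1
      exact (Fin.append_castAdd_natAdd).symm
    obtain ⟨h1, h2⟩ := List.append_inj (ha.trans this) (by simp)
    refine ⟨_, h2, ?_⟩
    have hv : v = fun i => a (Fin.castAdd k i) := by
      ext i
      exact congrFun (List.ofFn_injective h1) i
    rw [← realize_joinFormula, hv, ← e]
    exact h
  · rintro ⟨w, rfl, h⟩
    refine (pair_mem_elemDiagram_iff g N).2 ⟨Fin.append v w, ?_, (realize_joinFormula φ v w).2 h⟩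
    rw [← List.ofFn_fin_append]
    congr 1
    ext i
    refine Fin.addCases (fun i => ?_) (fun i => ?_) i <;> simp

end ParamFormulas

/-! ## Elementary substructures of coded structures -/

section ElemSub

variable {M N : CodedStructure L}

/-- The inclusion of an elementary coded substructure. -/
def ElemSub.emb (h : ElemSub M N) : ↥M.carrier ↪ₑ[L] ↥N.carrier where
  toFun a := ⟨a, h.subset a.2⟩
  map_formula' k φ a := (h.elem k φ a).symm

theorem ElemSub.trans {N' : CodedStructure L} (h : ElemSub M N) (h' : ElemSub N N') :
    ElemSub M N' where
  subset := h.subset.trans h'.subset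
  elem k φ a := (h.elem k φ a).trans (h'.elem k φ _)

theorem ElemSub.refl (M : CodedStructure L) : ElemSub M M where
  subset := subset_rfl
  elem _ _ _ := Iff.rfl

theorem ElemSub.models (h : ElemSub M N) {T : L.Theory} (hM : M.Models T) : N.Models T :=
  fun φ hφ => (h.emb.map_sentence φ).1 (hM φ hφ)

theorem RealizesType.mono {N' : CodedStructure L} {n : ℕ} {p : Set (ParamFormula L M n)}
    (h : ElemSub M N) (h' : ElemSub N N') (hp : RealizesType h.subset p) :
    RealizesType (h.trans h').subset p := by
  obtain ⟨b, hb⟩ := hp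
  refine ⟨fun i => h'.emb (b i), fun q hq => ?_⟩
  have := (h'.emb.map_formula q.2.1 _).2 (hb q hq)
  rwa [Sum.comp_elim] at this

theorem IsNType.mem_iff {A : Set ℕ} {n : ℕ} {p : Set (ParamFormula L M n)}
    (hp : IsNType M A n p) (h : ElemSub M N) {b : Fin n → ↥N.carrier}
    (hb : ∀ q ∈ p, q.2.1.Realize (Sum.elim b fun i => h.emb (q.2.2 i)))
    (q : ParamFormula L M n) :
    q ∈ p ↔ paramsIn A q ∧ q.2.1.Realize (Sum.elim b fun i => h.emb (q.2.2 i)) := by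
  refine ⟨fun hq => ⟨hp.1 q hq, hb q hq⟩, fun ⟨h1, h2⟩ => ?_⟩
  by_contra hq
  refine hp.2.2 q h1 hq ⟨↥N.carrier, N.struc, h.emb, b, ?_⟩
  rintro q' (rfl | hq')
  · exact h2
  · exact hb q' hq'

theorem ArithDecidable.carrier {g : GoedelCoding L} (hN : ArithDecidable g N) :
    ArF fun c => c ∈ N.carrier := by
  have hD := isArithmetical_iff_arF.1 hN
  let φ : L.Formula (Fin 1) := Term.equal (Term.var 0) (Term.var 0)
  have : ArF fun c => Nat.pair (formulaIndex g φ) (listCode [c]) ∈ elemDiagram g N := by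
    fun_prop
  refine this.of_iff fun c => ?_
  rw [pair_mem_elemDiagram_iff]
  constructor
  · exact fun h => ⟨fun _ => ⟨c, h⟩, by simp, by simp [φ, Formula.realize_equal]⟩
  · rintro ⟨a, h, -⟩
    simp only [List.ofFn_succ, List.ofFn_zero, List.cons.injEq, and_true] at h
    rw [h]
    exact (a 0).2

/-- A type realized in an arithmetically decidable elementary extension is arithmetic. -/
theorem IsNType.isArithmetical {A : Set ℕ} {n : ℕ} {p : Set (ParamFormula L M n)}
    {g : GoedelCoding L} (hp : IsNType M A n p) (hA : A ⊆ M.carrier) (hA' : IsArithmetical A)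
    (h : ElemSub M N) (hN : ArithDecidable g N) (hr : RealizesType h.subset p) :
    IsArithmetical (typeCode g p) := by
  obtain ⟨b, hb⟩ := hr
  have hD := isArithmetical_iff_arF.1 hN
  have hA' := isArithmetical_iff_arF.1 hA'
  have hmem := hp.mem_iff h hb
  rw [isArithmetical_iff_arF]
  have hs := fun {α : Type} [Primcodable α] {f : α → ℕ} (hf : ArF f) =>
    ArF.recode (arF_splitVar n) hf
  have : ArF fun c => ∃ (k f : ℕ) (l : List ℕ),
      c = Nat.pair (Nat.pair k (recode (splitVar n) f)) (listCode l) ∧ (∀ x, x ∈ l → x ∈ A) ∧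
      Nat.pair (Nat.pair (n + k) f) (listCode (List.ofFn (fun i => (b i : ℕ)) ++ l)) ∈
        elemDiagram g N := by
    refine .ex (.ex (.ex (.and (.eq (by fun_prop) (.natPair (.natPair (by fun_prop)
      (hs (by fun_prop))) (by fun_prop))) ?_)))
    fun_prop
  refine this.of_iff fun c => ?_
  constructor
  · rintro ⟨q, hq, rfl⟩
    refine ⟨q.1, formulaCode g Fin.val (joinFormula q.2.1), List.ofFn fun i => (q.2.2 i : ℕ),
      ?_, ?_, (mem_elemDiagram_joinFormula_iff g).2 ⟨_, rfl, hb q hq⟩⟩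
    · rw [recode_splitVar]
      rfl
    · intro x hx
      obtain ⟨i, rfl⟩ := (List.mem_ofFn' _ _).1 hx
      exact hp.1 q hq i
  · rintro ⟨k, f, l, rfl, hl, hD⟩
    obtain ⟨k', ψ, a, hc, -⟩ := id hD
    simp only [Nat.pair_eq_pair] at hc
    obtain ⟨⟨rfl, rfl⟩, -⟩ := hc
    obtain ⟨φ, hφ⟩ := exists_joinFormula_eq g ψ
    rw [← hφ] at hD ⊢
    obtain ⟨w, rfl, hw⟩ := (mem_elemDiagram_joinFormula_iff g).1 hD
    have hw' : ∀ i, (w i : ℕ) ∈ A := fun i => hl _ ((List.mem_ofFn' _ _).2 ⟨i, rfl⟩)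
    refine ⟨⟨k, φ, fun i => ⟨w i, hA (hw' i)⟩⟩, (hmem _).2 ⟨hw', hw⟩, ?_⟩
    rw [recode_splitVar]
    rfl

end ElemSub

/-! ## Course-of-values recursion -/

/-- The function defined by course-of-values recursion. -/
def covRec {β : Type} (G : List β → β) (e : ℕ) : β :=
  G ((List.range e).attach.map fun j => covRec G j.1)
termination_by e
decreasing_by exact List.mem_range.1 j.2

theorem covRec_eq {β : Type} (G : List β → β) (e : ℕ) :
    covRec G e = G ((List.range e).map (covRec G)) := by
  rw [covRec]
  congr 1
  simp

theorem ArF.covRec {α β : Type} [Primcodable α] [Primcodable β] {G : α → List β → β}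
    (hG : ArF fun p : α × List β => G p.1 p.2) : ArF fun p : α × ℕ => covRec (G p.1) p.2 :=
  ArF.strongRec hG fun a e => covRec_eq (G a) e

/-! ## Arithmetical ultrafilters -/

section Ultrafilter

variable (R : ℕ → ℕ → Prop) (P : ℕ → Prop)

/-- The greedy choice, along the sequence of sets `R i`, of a maximal family with the finite
intersection property extending the family indexed by `P`. -/
def greedy : ℕ → Prop :=
  covRec fun l => ∀ m, ∃ x, (∀ (j : ℕ) (b : Prop), l[j]? = some b → (b ↔ R j x)) ∧
    R l.length x ∧ ∀ i, i < m → P i → R i x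

variable {R P}

theorem arF_greedy (hR : ArF fun p : ℕ × ℕ => R p.1 p.2) (hP : ArF P) : ArF (greedy R P) := by
  have hc := ArF.covRec (α := Unit) (G := fun _ l =>
    ∀ m, ∃ x, (∀ (j : ℕ) (b : Prop), l[j]? = some b → (b ↔ R j x)) ∧
    R l.length x ∧ ∀ i, i < m → P i → R i x) ?_
  · exact ArF.comp (g := fun e : ℕ => ((), e)) hc (by fun_prop)
  refine .all (.ex (.and (.all (.all (.imp (by fun_prop) (.iff (by fun_prop) ?_))))
    (.and ?_ (.all (.imp (by fun_prop) (.imp (by fun_prop) ?_))))))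
  all_goals exact .comp₂ hR (by fun_prop) (by fun_prop)

theorem greedy_iff (e : ℕ) : greedy R P e ↔ ∀ m, ∃ x, (∀ j < e, (greedy R P j ↔ R j x)) ∧
    R e x ∧ ∀ i, i < m → P i → R i x := by
  have h (x : ℕ) : (∀ (j : ℕ) (b : Prop), ((List.range e).map (greedy R P))[j]? = some b →
      (b ↔ R j x)) ↔ ∀ j < e, (greedy R P j ↔ R j x) := by
    constructor
    · intro h j hj
      exact h j _ (by simp [hj])
    · intro h j b hb
      obtain ⟨hj, rfl⟩ : j < e ∧ greedy R P j = b := by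
        obtain ⟨hj, rfl⟩ := List.getElem?_eq_some_iff.1 hb
        simpa using hj
      exact h j hj
  conv_lhs => rw [greedy, covRec_eq, ← greedy]
  simp only [h, List.length_map, List.length_range]

theorem exists_greedy (h : ∀ m, ∃ x, ∀ i, i < m → P i → R i x) (e m : ℕ) :
    ∃ x, (∀ j < e, (greedy R P j ↔ R j x)) ∧ ∀ i, i < m → P i → R i x := by
  induction e generalizing m with
  | zero => simpa using h m
  | succ e ih =>
    simp only [Nat.forall_lt_succ_right]
    by_cases he : greedy R P e
    · obtain ⟨x, h1, h2, h3⟩ := (greedy_iff e).1 he m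
      exact ⟨x, ⟨h1, by tauto⟩, h3⟩
    · have := he
      rw [greedy_iff] at this
      push Not at this
      obtain ⟨m₀, hm₀⟩ := this
      obtain ⟨x, h1, h2⟩ := ih (max m m₀)
      refine ⟨x, ⟨h1, ?_⟩, fun i hi => h2 i (lt_max_of_lt_left hi)⟩
      refine iff_of_false he fun hx => ?_
      obtain ⟨i, hi, hi', hi''⟩ := hm₀ x h1 hx
      exact hi'' (h2 i (lt_max_of_lt_right hi) hi')

theorem greedy_of (h : ∀ m, ∃ x, ∀ i, i < m → P i → R i x) {i : ℕ} (hi : P i) :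
    greedy R P i := by
  obtain ⟨x, h1, h2⟩ := exists_greedy h (i + 1) (i + 1)
  exact (h1 i (Nat.lt_succ_self i)).2 (h2 i (Nat.lt_succ_self i) hi)

theorem exists_ultrafilter_greedy (h : ∀ m, ∃ x, ∀ i, i < m → P i → R i x) :
    ∃ 𝒰 : Ultrafilter ℕ, ∀ i, (∀ᶠ x in (𝒰 : Filter ℕ), R i x) ↔ greedy R P i := by
  let S : ℕ → Set ℕ := fun e => {x | ∀ j < e, (greedy R P j ↔ R j x)}
  have hS : Antitone S := fun d e hde x hx j hj => hx j (hj.trans_le hde)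
  have : Filter.NeBot (⨅ e, Filter.principal (S e)) := by
    refine Filter.iInf_neBot_of_directed' ?_ fun e => ?_
    · exact Antitone.directed_ge fun d e hde => Filter.principal_mono.2 (hS hde)
    · obtain ⟨x, hx, -⟩ := exists_greedy h e 0
      exact Filter.principal_neBot_iff.2 ⟨x, hx⟩
  refine ⟨Ultrafilter.of (⨅ e, Filter.principal (S e)), fun i => ?_⟩
  have hi : ∀ᶠ x in (Ultrafilter.of (⨅ e, Filter.principal (S e)) : Filter ℕ),
      (greedy R P i ↔ R i x) := by
    refine Ultrafilter.of_le _ (Filter.mem_iInf_of_mem (i + 1) ?_)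
    exact fun x hx => hx i (Nat.lt_succ_self i)
  constructor
  · intro hR
    obtain ⟨x, h1, h2⟩ := (hi.and hR).exists
    exact h1.2 h2
  · intro hu
    filter_upwards [hi] with x hx using hx.1 hu

end Ultrafilter

/-! ## Indexed Skolem functions -/

@[fun_prop]
theorem ArF.natSInf {α : Type} [Primcodable α] {P : α → ℕ → Prop}
    (hP : ArF fun p : α × ℕ => P p.1 p.2) : ArF fun a => sInf {y | P a y} := by
  have hP' {γ : Type} [Primcodable γ] {f : γ → α} {g : γ → ℕ} (hf : ArF f) (hg : ArF g) :
      ArF fun c => P (f c) (g c) := .comp₂ hP hf hg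
  refine .of_graph_iff (G := fun a z => (P a z ∧ ∀ y, y < z → ¬ P a y) ∨ (z = 0 ∧ ∀ y, ¬ P a y))
    ?_ fun a z => ?_
  · refine .or (.and (hP' (by fun_prop) (by fun_prop)) (.all (.imp (by fun_prop) (.not ?_))))
      (.and (by fun_prop) (.all (.not ?_)))
    all_goals exact hP' (by fun_prop) (by fun_prop)
  · constructor
    · rintro rfl
      by_cases h : {y | P a y}.Nonempty
      · exact .inl ⟨Nat.sInf_mem h, fun y => Nat.notMem_of_lt_sInf⟩
      · rw [Set.not_nonempty_iff_eq_empty] at h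
        exact .inr ⟨by simp [h], fun y hy => Set.eq_empty_iff_forall_notMem.1 h y hy⟩
    · rintro (⟨h1, h2⟩ | ⟨rfl, h⟩)
      · exact le_antisymm (Nat.sInf_le h1) (not_lt.1 fun h => h2 _ h (Nat.sInf_mem ⟨z, h1⟩))
      · simp [h]

theorem lt_listCode_of_mem {l : List ℕ} {j : ℕ} (h : j ∈ l) : j < listCode l := by
  induction l with
  | nil => simp at h
  | cons a l ih =>
    rw [listCode, Encodable.encode_list_cons]
    rcases List.mem_cons.1 h with rfl | h
    · exact Nat.lt_succ_of_le (Nat.left_le_pair _ _)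
    · exact (ih h).trans (Nat.lt_succ_of_le (Nat.right_le_pair _ _))

section Index

variable (C D : Set ℕ) (c₀ : ℕ)

/-- The intended value at `x` of the function with index `Nat.pair t u`, given the list `l` of the
values at `x` of the functions with smaller index: constants for `t = 0`, coordinates of the argument
for `t = 1`, and least witnesses for `{l | pair m (listCode l) ∈ D}` for `t = m + 2`. -/
noncomputable def indexValue (x t u : ℕ) (l : List ℕ) : ℕ :=
  if t = 0 then u else if t = 1 then (decodeD (List ℕ) x).getD u 0 else
    sInf {y | Nat.pair (t - 2) (listCode ((decodeD (List ℕ) u).map (fun j => l.getD j 0) ++ [y])) ∈ D}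

open Classical in
/-- The intended value if it belongs to `C`, and the default value `c₀` otherwise. -/
noncomputable def indexStep (x : ℕ) (l : List ℕ) : ℕ :=
  if indexValue D x l.length.unpair.1 l.length.unpair.2 l ∈ C then
    indexValue D x l.length.unpair.1 l.length.unpair.2 l else c₀

/-- The value at `x` of the function with index `e`. -/
noncomputable def indexFun (x e : ℕ) : ℕ := covRec (indexStep C D c₀ x) e

variable {C D c₀}

theorem arF_indexFun (hC : ArF fun n => n ∈ C) (hD : ArF fun n => n ∈ D) :
    ArF fun p : ℕ × ℕ => indexFun C D c₀ p.1 p.2 := by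
  refine ArF.covRec ?_
  unfold indexStep indexValue
  fun_prop

theorem indexFun_mem (hc : c₀ ∈ C) (x e : ℕ) : indexFun C D c₀ x e ∈ C := by
  rw [indexFun, covRec_eq, indexStep]
  split_ifs <;> assumption

open Classical in
theorem indexFun_pair (x t u : ℕ) {v : ℕ} (hv : v ∈ C) (h : indexValue D x t u
      ((List.range (Nat.pair t u)).map (indexFun C D c₀ x)) = v) :
    indexFun C D c₀ x (Nat.pair t u) = v := by
  rw [indexFun, covRec_eq, indexStep, List.length_map, List.length_range, Nat.unpair_pair]
  change (if indexValue D x t u ((List.range (Nat.pair t u)).map (indexFun C D c₀ x)) ∈ C then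
    indexValue D x t u ((List.range (Nat.pair t u)).map (indexFun C D c₀ x)) else c₀) = v
  rw [h, if_pos hv]

theorem indexFun_const {u : ℕ} (hu : u ∈ C) (x : ℕ) : indexFun C D c₀ x (Nat.pair 0 u) = u :=
  indexFun_pair x 0 u hu (by simp [indexValue])

theorem indexFun_proj {l : List ℕ} {u : ℕ} (hu : l.getD u 0 ∈ C) :
    indexFun C D c₀ (listCode l) (Nat.pair 1 u) = l.getD u 0 :=
  indexFun_pair _ 1 u hu (by simp [indexValue])

theorem indexFun_witness (hD : ∀ m l, Nat.pair m (listCode l) ∈ D → ∀ x ∈ l, x ∈ C) {x m y : ℕ}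
    {l : List ℕ} (hy : Nat.pair m (listCode (l.map (indexFun C D c₀ x) ++ [y])) ∈ D) :
    Nat.pair m (listCode (l.map (indexFun C D c₀ x) ++
      [indexFun C D c₀ x (Nat.pair (m + 2) (listCode l))])) ∈ D := by
  set e := Nat.pair (m + 2) (listCode l) with he
  have hl : l.map (fun j => ((List.range e).map (indexFun C D c₀ x)).getD j 0) =
      l.map (indexFun C D c₀ x) := by
    refine List.map_congr_left fun j hj => ?_
    have : j < e := (lt_listCode_of_mem hj).trans_le (Nat.right_le_pair _ _)
    simp [this]
  have hv := Nat.sInf_mem (s := {y | Nat.pair m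
    (listCode (l.map (indexFun C D c₀ x) ++ [y])) ∈ D}) ⟨y, hy⟩
  rw [indexFun_pair x (m + 2) (listCode l) (hD _ _ hv _ (List.mem_append_right _ (List.mem_singleton_self _))) ?_]
  · exact hv
  · simp only [indexValue, ← he, decodeD_listCode, hl, Nat.add_sub_cancel]
    simp

end Index

/-! ## Skolem ultrapowers -/

theorem exists_skolem_ultrapower {A I : Type} [L.Structure A] [Nonempty A] (𝒰 : Ultrafilter I)
    (F : ℕ → I → A)
    (hF : ∀ (k : ℕ) (φ : L.Formula (Fin (k + 1))) (s : Fin k → ℕ), ∃ e, ∀ x a,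
      φ.Realize (Fin.snoc (fun i => F (s i) x) a : Fin (k + 1) → A) →
        φ.Realize (Fin.snoc (fun i => F (s i) x) (F e x) : Fin (k + 1) → A)) :
    ∃ (S : Type) (_ : L.Structure S) (q : ℕ → S), Function.Surjective q ∧
      ∀ (k : ℕ) (φ : L.Formula (Fin k)) (s : Fin k → ℕ),
        φ.Realize (fun i => q (s i)) ↔ ∀ᶠ x in (𝒰 : Filter I), φ.Realize fun i => F (s i) x := by
  let Q := (𝒰 : Filter I).Product fun _ => A
  let mk : (I → A) → Q := fun f => (f : (𝒰 : Filter I).Product fun _ => A)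
  let S : L.Substructure Q :=
    { carrier := Set.range fun e => mk (F e)
      fun_mem := by
        intro k f v hv
        choose s hs using hv
        obtain ⟨e, he⟩ := hF k (Term.equal (Term.func f fun i => Term.var i.castSucc)
          (Term.var (Fin.last k))) s
        refine ⟨e, ?_⟩
        have hv : v = fun i => mk (F (s i)) := funext fun i => (hs i).symm
        rw [hv]
        refine Eq.trans ?_ (Ultraproduct.funMap_cast (u := 𝒰) f fun i => F (s i)).symm
        refine congrArg mk (funext fun x => ?_)
        have := he x (Structure.funMap f fun i => F (s i) x) (by simp [Formula.realize_equal])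
        simpa [Formula.realize_equal] using this.symm }
  have hS : S.IsElementary := by
    refine S.isElementary_of_exists fun k φ v a h => ?_
    choose s hs using fun i => (v i).2
    obtain ⟨f, rfl⟩ : ∃ f, mk f = a := Quotient.exists_rep a
    obtain ⟨e, he⟩ := hF k (rename (Sum.elim Empty.elim id) φ.toFormula) s
    refine ⟨⟨mk (F e), e, rfl⟩, ?_⟩
    have hv : ((↑) ∘ v : Fin k → Q) = fun i => mk (F (s i)) := funext fun i => (hs i).symm
    have key (b : I → A) : φ.Realize (M := Q) default (Fin.snoc ((↑) ∘ v) (mk b) : _ → Q) ↔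
        ∀ᶠ x in (𝒰 : Filter I), φ.Realize default
          (Fin.snoc (fun i => F (s i) x) (b x) : Fin (k + 1) → A) := by
      have h1 : (default : Empty → Q) = fun i : Empty => mk i.elim := Subsingleton.elim _ _
      have h2 : (Fin.snoc ((↑) ∘ v) (mk b) : Fin (k + 1) → Q) =
          fun i => mk ((Fin.snoc (fun i => F (s i)) b : Fin (k + 1) → I → A) i) := by
        rw [hv]
        ext i
        refine Fin.lastCases ?_ (fun i => ?_) i <;> simp
      rw [h1, h2]
      refine (Ultraproduct.boundedFormula_realize_cast (u := 𝒰) φ _ _).trans ?_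
      refine Filter.eventually_congr (.of_forall fun x => ?_)
      congr!
      rename_i i
      refine Fin.lastCases ?_ (fun i => ?_) i <;> simp
    rw [key] at h
    refine (key _).2 (h.mono fun x hx => ?_)
    have hr (a : A) : Formula.Realize (rename (Sum.elim Empty.elim id) φ.toFormula : L.Formula _)
        (Fin.snoc (fun i => F (s i) x) a : Fin (k + 1) → A) ↔
        φ.Realize default (Fin.snoc (fun i => F (s i) x) a : Fin (k + 1) → A) := by
      rw [realize_rename_formula, BoundedFormula.realize_toFormula]
      congr!
    exact (hr _).1 (he x _ ((hr _).2 hx))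
  refine ⟨S, inferInstance, fun e => ⟨mk (F e), e, rfl⟩, ?_, fun k φ s => ?_⟩
  · rintro ⟨_, e, rfl⟩
    exact ⟨e, rfl⟩
  · rw [← hS φ]
    exact Ultraproduct.realize_formula_cast (u := 𝒰) φ fun i => F (s i)

/-- A structure indexed by `ℕ` can be given any carrier. -/
theorem exists_codedStructure {S : Type} [L.Structure S] {q : ℕ → S} (hq : Function.Surjective q)
    {κ : ℕ → ℕ} (hκ : ∀ i j, κ i = κ j ↔ q i = q j) (hκ' : (Set.range κ)ᶜ.Infinite) :
    ∃ N : CodedStructure L, ∃ h : N.carrier = Set.range κ,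
      ∀ (k : ℕ) (φ : L.Formula (Fin k)) (s : Fin k → ℕ),
        φ.Realize (fun i => (⟨κ (s i), h ▸ ⟨s i, rfl⟩⟩ : ↥N.carrier)) ↔
          φ.Realize fun i => q (s i) := by
  let f : Set.range κ → S := fun c => q c.2.choose
  have hf (i : ℕ) (h : κ i ∈ Set.range κ) : f ⟨κ i, h⟩ = q i := (hκ _ _).1 h.choose_spec
  have hf' : Function.Bijective f := by
    constructor
    · rintro ⟨_, i, rfl⟩ ⟨_, j, rfl⟩ h
      rw [hf i ⟨i, rfl⟩, hf j ⟨j, rfl⟩] at h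
      exact Subtype.ext ((hκ i j).2 h)
    · intro x
      obtain ⟨i, rfl⟩ := hq x
      exact ⟨⟨κ i, i, rfl⟩, hf i _⟩
  let e : S ≃ Set.range κ := (Equiv.ofBijective f hf').symm
  refine ⟨⟨Set.range κ, hκ', e.inducedStructure⟩, rfl, fun k φ s => ?_⟩
  let := e.inducedStructure (L := L)
  have := (StrongHomClass.realize_formula (e.inducedStructureEquiv (L := L)) φ
    (v := fun i => q (s i)))
  rw [← this]
  congr!
  rename_i i
  have : e (q (s i)) = ⟨κ (s i), s i, rfl⟩ := (Equiv.symm_apply_eq _).2 (hf _ _).symm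
  exact congrArg Subtype.val this.symm

/-! ## Names for the elements of a quotient -/

theorem ArF.nth {p : ℕ → Prop} (hp : ArF p) : ArF (Nat.nth p) := by
  have := ArF.strongRec (α := Unit) (f := fun _ => Nat.nth p)
    (G := fun _ l => sInf {x | p x ∧ ∀ y, y ∈ l → y < x}) (by fun_prop) fun _ e => by
      rw [Nat.nth_eq_sInf]
      simp
  exact ArF.comp (g := fun e : ℕ => ((), e)) this (by fun_prop)

theorem exists_arF_names {C : Set ℕ} (hC : ArF fun n => n ∈ C) (hC' : Cᶜ.Infinite)
    {E : ℕ → ℕ → Prop} (hE : ArF fun p : ℕ × ℕ => E p.1 p.2) (hE' : Equivalence E)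
    (hEC : ∀ c ∈ C, ∀ d ∈ C, E (Nat.pair 0 c) (Nat.pair 0 d) → c = d) :
    ∃ κ : ℕ → ℕ, ArF κ ∧ (∀ i j, κ i = κ j ↔ E i j) ∧ (∀ c ∈ C, κ (Nat.pair 0 c) = c) ∧
      (Set.range κ)ᶜ.Infinite := by
  classical
  have hE₂ {γ : Type} [Primcodable γ] {f g : γ → ℕ} (hf : ArF f) (hg : ArF g) :
      ArF fun c => E (f c) (g c) := .comp₂ hE hf hg
  have hnth : ArF (Nat.nth (· ∉ C)) := ArF.nth (by fun_prop)
  have hinj : Function.Injective (Nat.nth (· ∉ C)) := Nat.nth_injective hC'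
  have hmem (k : ℕ) : Nat.nth (· ∉ C) k ∉ C := Nat.nth_mem_of_infinite hC' k
  let S : ℕ → Set ℕ := fun i => {c | c ∈ C ∧ E i (Nat.pair 0 c)}
  let κ : ℕ → ℕ := fun i => if ∃ c, c ∈ C ∧ E i (Nat.pair 0 c) then
    sInf {c | c ∈ C ∧ E i (Nat.pair 0 c)} else Nat.nth (· ∉ C) (2 * sInf {j | E i j} + 1)
  have hpos {i : ℕ} (h : (S i).Nonempty) : κ i ∈ S i := by
    have : κ i = sInf (S i) := if_pos h
    rw [this]
    exact Nat.sInf_mem h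
  have hneg {i : ℕ} (h : ¬ (S i).Nonempty) : κ i = Nat.nth (· ∉ C) (2 * sInf {j | E i j} + 1) :=
    if_neg h
  have hcls (i : ℕ) : E i (sInf {j | E i j}) := Nat.sInf_mem (s := {j | E i j}) ⟨i, hE'.refl i⟩
  refine ⟨κ, ?_, fun i j => ⟨fun h => ?_, fun h => ?_⟩, fun c hc => ?_, ?_⟩
  · refine .ite (.ex (.and (by fun_prop) (hE₂ (by fun_prop) (by fun_prop))))
      (.natSInf (.and (by fun_prop) (hE₂ (by fun_prop) (by fun_prop))))
      (.comp hnth (.natAdd (.natMul (.const 2) (.natSInf (hE₂ (by fun_prop) (by fun_prop))))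
        (.const 1)))
  · by_cases hi : (S i).Nonempty <;> by_cases hj : (S j).Nonempty
    · exact hE'.trans (h ▸ (hpos hi).2) (hE'.symm (hpos hj).2)
    · exact absurd (hpos hi).1 (by rw [h, hneg hj]; exact hmem _)
    · exact absurd (hpos hj).1 (by rw [← h, hneg hi]; exact hmem _)
    · rw [hneg hi, hneg hj] at h
      have := hinj h
      have h' : sInf {k | E i k} = sInf {k | E j k} := by omega
      exact hE'.trans (h' ▸ hcls i) (hE'.symm (hcls j))
  · have : E i = E j := funext fun k => propext
      ⟨fun hk => hE'.trans (hE'.symm h) hk, fun hk => hE'.trans h hk⟩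
    simp only [κ, this]
  · have := hpos (i := Nat.pair 0 c) ⟨c, hc, hE'.refl _⟩
    exact (hEC c hc _ this.1 this.2).symm
  · refine Set.infinite_of_injective_forall_mem (f := fun m => Nat.nth (· ∉ C) (2 * m))
      (fun a b h => by simpa using hinj h) fun m => ?_
    rintro ⟨i, hi⟩
    by_cases h : (S i).Nonempty
    · exact hmem _ (hi ▸ (hpos h).1)
    · rw [hneg h] at hi
      have := hinj hi
      omega

/-! ## Arithmetically decidable elementary extensions -/

section Extension

variable (g : GoedelCoding L) (N : CodedStructure L) (c₀ : ℕ)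

/-- The relation with a given index, a pair of codes of a formula and of a list of indices of
functions, at `x`. -/
def indexRel (i x : ℕ) : Prop :=
  Nat.pair i.unpair.1 (listCode ((decodeD (List ℕ) i.unpair.2).map
    (indexFun N.carrier (elemDiagram g N) c₀ x))) ∈ elemDiagram g N

variable {g N c₀}

theorem ArithDecidable.arF_indexRel (hN : ArithDecidable g N) :
    ArF fun p : ℕ × ℕ => indexRel g N c₀ p.1 p.2 := by
  have hD := isArithmetical_iff_arF.1 hN
  have hF {γ : Type} [Primcodable γ] {f h : γ → ℕ} (hf : ArF f) (hh : ArF h) :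
      ArF fun c => indexFun N.carrier (elemDiagram g N) c₀ (f c) (h c) :=
    .comp₂ (arF_indexFun hN.carrier hD) hf hh
  unfold indexRel
  refine .comp hD (.natPair (by fun_prop) (.listCode (.listMap (by fun_prop) (hF ?_ ?_))))
  all_goals fun_prop

theorem indexRel_pair (m : ℕ) (l : List ℕ) (x : ℕ) :
    indexRel g N c₀ (Nat.pair m (listCode l)) x ↔
      Nat.pair m (listCode (l.map (indexFun N.carrier (elemDiagram g N) c₀ x))) ∈
        elemDiagram g N := by
  simp [indexRel]

theorem pair_formulaIndex_mem_elemDiagram_iff {k : ℕ} (φ : L.Formula (Fin k))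
    (a : Fin k → ↥N.carrier) :
    Nat.pair (formulaIndex g φ) (listCode (List.ofFn fun i => (a i : ℕ))) ∈ elemDiagram g N ↔
      φ.Realize a := by
  rw [pair_mem_elemDiagram_iff]
  constructor
  · rintro ⟨b, hb, h⟩
    have : a = b := funext fun i => Subtype.ext (congrFun (List.ofFn_injective hb) i)
    rwa [this]
  · exact fun h => ⟨a, rfl, h⟩

theorem mem_carrier_of_pair_mem_elemDiagram {m : ℕ} {l : List ℕ}
    (h : Nat.pair m (listCode l) ∈ elemDiagram g N) {x : ℕ} (hx : x ∈ l) : x ∈ N.carrier := by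
  obtain ⟨k, φ, a, hc, -⟩ := h
  obtain ⟨-, hc⟩ := Nat.pair_eq_pair.1 hc
  rw [listCode_injective hc] at hx
  obtain ⟨i, rfl⟩ := (List.mem_ofFn' _ _).1 hx
  exact (a i).2

/-- An arithmetically decidable structure has an arithmetically decidable elementary extension
realizing all the relations of a finitely satisfiable arithmetical family. -/
theorem ArithDecidable.exists_extension (hN : ArithDecidable g N) (hc : c₀ ∈ N.carrier)
    {P : ℕ → Prop} (hP : ArF P) (h : ∀ m, ∃ x, ∀ i, i < m → P i → indexRel g N c₀ i x) :
    ∃ N' : CodedStructure L, ElemSub N N' ∧ ArithDecidable g N' ∧ ∃ κ : ℕ → ↥N'.carrier,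
      (∀ c ∈ N.carrier, (κ (Nat.pair 0 c) : ℕ) = c) ∧
      ∀ (k : ℕ) (φ : L.Formula (Fin k)) (s : Fin k → ℕ),
        P (Nat.pair (formulaIndex g φ) (listCode (List.ofFn s))) →
          φ.Realize fun i => κ (s i) := by
  obtain ⟨𝒰, h𝒰⟩ := exists_ultrafilter_greedy h
  have hgr := arF_greedy (hN.arF_indexRel (c₀ := c₀)) hP
  have hgP := fun i => greedy_of h (i := i)
  set U := greedy (indexRel g N c₀) P
  let F : ℕ → ℕ → ↥N.carrier := fun e x => ⟨indexFun N.carrier (elemDiagram g N) c₀ x e,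
    indexFun_mem hc x e⟩
  have hR {k : ℕ} (φ : L.Formula (Fin k)) (s : Fin k → ℕ) (x : ℕ) :
      indexRel g N c₀ (Nat.pair (formulaIndex g φ) (listCode (List.ofFn s))) x ↔
        φ.Realize fun i => F (s i) x := by
    rw [indexRel_pair, ← pair_formulaIndex_mem_elemDiagram_iff (g := g), List.map_ofFn]
    rfl
  have hsnoc {k : ℕ} (s : Fin k → ℕ) (x : ℕ) (a : ↥N.carrier) :
      (List.ofFn s).map (indexFun N.carrier (elemDiagram g N) c₀ x) ++ [(a : ℕ)] =
      List.ofFn fun i => ((Fin.snoc (fun i => F (s i) x) a : Fin (k + 1) → ↥N.carrier) i : ℕ) := by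
    rw [List.ofFn_succ', List.concat_eq_append, List.map_ofFn]
    simp [F, Function.comp_def]
  have : Nonempty ↥N.carrier := ⟨⟨c₀, hc⟩⟩
  obtain ⟨S, _, q, hq, hqF⟩ := exists_skolem_ultrapower (L := L) 𝒰 F fun k φ s =>
      ⟨Nat.pair (formulaIndex g φ + 2) (listCode (List.ofFn s)), fun x a ha => by
    rw [← pair_formulaIndex_mem_elemDiagram_iff (g := g), ← hsnoc] at ha ⊢
    exact indexFun_witness (fun _ _ => mem_carrier_of_pair_mem_elemDiagram) ha⟩
  have hU {k : ℕ} (φ : L.Formula (Fin k)) (s : Fin k → ℕ) :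
      U (Nat.pair (formulaIndex g φ) (listCode (List.ofFn s))) ↔ φ.Realize fun i => q (s i) := by
    rw [← h𝒰, hqF]
    simp only [hR]
  let eqF : L.Formula (Fin 2) := Term.equal (Term.var 0) (Term.var 1)
  have hE (i j : ℕ) : U (Nat.pair (formulaIndex g eqF) (listCode [i, j])) ↔ q i = q j := by
    have := hU eqF ![i, j]
    simpa [eqF, Formula.realize_equal] using this
  have hconst {c : ℕ} (hc : c ∈ N.carrier) (x : ℕ) : F (Nat.pair 0 c) x = ⟨c, hc⟩ :=
    Subtype.ext (indexFun_const hc x)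
  obtain ⟨κ, hκ, hκE, hκC, hκ'⟩ := exists_arF_names hN.carrier N.compl_infinite
    (E := fun i j => U (Nat.pair (formulaIndex g eqF) (listCode [i, j])))
    (by fun_prop) (by simp only [hE]; exact ⟨fun _ => rfl, Eq.symm, Eq.trans⟩) (by
      intro c hc d hd h
      have h' := (hqF 2 eqF ![Nat.pair 0 c, Nat.pair 0 d]).1
        (by simpa [eqF, Formula.realize_equal] using (hE _ _).1 h)
      obtain ⟨x, hx⟩ := h'.exists
      simpa [eqF, Formula.realize_equal, hconst hc, hconst hd] using hx)
  obtain ⟨N', hN', hq'⟩ := exists_codedStructure (L := L) hq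
    (fun i j => (hκE i j).trans (hE i j)) hκ'
  let κ' : ℕ → ↥N'.carrier := fun i => ⟨κ i, hN' ▸ ⟨i, rfl⟩⟩
  replace hq' {k : ℕ} (φ : L.Formula (Fin k)) (s : Fin k → ℕ) :
    φ.Realize (fun i => κ' (s i)) ↔ φ.Realize fun i => q (s i) := hq' k φ s
  have hsub : N.carrier ⊆ N'.carrier := fun c hc => by
    rw [hN']
    exact ⟨_, hκC c hc⟩
  refine ⟨N', ⟨hsub, fun k φ a => ?_⟩, ?_, κ', hκC, fun k φ s hs => ?_⟩
  · have h1 : (fun i => (⟨a i, hsub (a i).2⟩ : ↥N'.carrier)) = fun i => κ' (Nat.pair 0 (a i)) :=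
      funext fun i => Subtype.ext (hκC _ (a i).2).symm
    rw [h1]
    refine Iff.trans ?_ ((hq' φ _).trans (hqF k φ _)).symm
    simp only [hconst (a _).2, Subtype.coe_eta, Filter.eventually_const]
  · rw [ArithDecidable, isArithmetical_iff_arF]
    have : ArF fun c => ∃ (m : ℕ) (s : List ℕ), c = Nat.pair m (listCode (s.map κ)) ∧
        U (Nat.pair m (listCode s)) := by fun_prop
    refine this.of_iff fun c => ⟨?_, ?_⟩
    · rintro ⟨k, φ, a, rfl, ha⟩
      have hs (i : Fin k) : ∃ j, κ j = a i := hN'.le (a i).2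
      choose s hs using hs
      have hs' : a = fun i => κ' (s i) := funext fun i => Subtype.ext (hs i).symm
      subst hs'
      refine ⟨formulaIndex g φ, List.ofFn s, ?_, (hU φ s).2 ((hq' φ s).1 ha)⟩
      rw [List.map_ofFn]
      rfl
    · rintro ⟨m, s, rfl, hs⟩
      obtain ⟨x, hx⟩ := ((h𝒰 _).2 hs).exists
      obtain ⟨k, φ, a, hc, -⟩ := (indexRel_pair _ _ _).1 hx
      obtain ⟨rfl, hl⟩ := Nat.pair_eq_pair.1 hc
      have hk : s.length = k := by simpa using congrArg List.length (listCode_injective hl)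
      obtain ⟨t, rfl⟩ : ∃ t : Fin k → ℕ, s = List.ofFn t := by
        subst hk
        exact ⟨s.get, (List.ofFn_get s).symm⟩
      refine ⟨k, φ, fun i => κ' (t i), ?_, (hq' φ t).2 ((hU φ t).1 hs)⟩
      rw [List.map_ofFn]
      rfl
  · exact (hq' φ s).2 ((hU φ s).1 (hgP _ hs))

end Extension

/-! ## Realizing arithmetic types -/

section Types

variable {M : CodedStructure L} {n : ℕ} {p : Set (ParamFormula L M n)}

/-- A type consistent with the elementary diagram of `M` is finitely satisfiable in `M`. -/
theorem TypeConsistent.exists_realize (hp : TypeConsistent M p) {β : Type} [Finite β]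
    (Q : β → ParamFormula L M n) (hQ : ∀ b, Q b ∈ p) :
    ∃ v : Fin n → ↥M.carrier, ∀ b, (Q b).2.1.Realize (Sum.elim v (Q b).2.2) := by
  obtain ⟨N, _, j, v, hv⟩ := hp
  let σ (b : β) : Fin n ⊕ Fin (Q b).1 → ↥M.carrier ⊕ Fin n :=
    Sum.elim Sum.inr fun i => Sum.inl ((Q b).2.2 i)
  let φ : L.Formula (↥M.carrier ⊕ Fin n) := BoundedFormula.iInf fun b => rename (σ b) (Q b).2.1
  have hφ {N : Type} [L.Structure N] (j : ↥M.carrier → N) :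
      (φ.iExs (Fin n)).Realize j ↔ ∃ v : Fin n → N, ∀ b,
        (Q b).2.1.Realize (Sum.elim v fun i => j ((Q b).2.2 i)) := by
    rw [Formula.realize_iExs]
    refine exists_congr fun v => BoundedFormula.realize_iInf.trans (forall_congr' fun b => ?_)
    refine (realize_rename_formula (σ b) (Q b).2.1 (Sum.elim j v)).trans ?_
    congr!
    rename_i s
    rcases s with i | i <;> rfl
  exact (hφ id).1 ((j.map_formula (φ.iExs (Fin n)) id).1
    ((hφ _).2 ⟨v, fun b => hv _ (hQ b)⟩))

/-- An arithmetic type is realized in an arithmetically decidable elementary extension. -/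
theorem TypeConsistent.exists_arithDecidable {g : GoedelCoding L} {N : CodedStructure L}
    (hp : TypeConsistent M p) (hp' : IsArithmetical (typeCode g p)) (h : ElemSub M N)
    (hN : ArithDecidable g N) (hne : N.carrier.Nonempty) :
    ∃ N' : CodedStructure L, ∃ h : ElemSub M N', ArithDecidable g N' ∧
      RealizesType h.subset p := by
  obtain ⟨c₀, hc₀⟩ := hne
  have hp' := isArithmetical_iff_arF.1 hp'
  let s (q : ParamFormula L M n) : Fin (n + q.1) → ℕ :=
    Fin.append (fun i => Nat.pair 1 i) fun i => Nat.pair 0 (q.2.2 i)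
  have hrange : (List.range n).map (Nat.pair 1) = List.ofFn fun i : Fin n => Nat.pair 1 i :=
    List.ext_getElem (by simp) (by simp)
  have hs (q : ParamFormula L M n) : List.ofFn (s q) = (List.range n).map (Nat.pair 1) ++
      (List.ofFn fun i => (q.2.2 i : ℕ)).map (Nat.pair 0) := by
    rw [List.ofFn_fin_append, List.map_ofFn, hrange]
    rfl
  let index (q : ParamFormula L M n) : ℕ :=
    Nat.pair (formulaIndex g (joinFormula q.2.1)) (listCode (List.ofFn (s q)))
  have hindex : ArF fun i => ∃ q ∈ p, i = index q := by
    have hj := fun {α : Type} [Primcodable α] {f : α → ℕ} (hf : ArF f) =>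
      ArF.recode (arF_joinVar n) hf
    have : ArF fun i => ∃ (k f : ℕ) (l : List ℕ),
        Nat.pair (Nat.pair k f) (listCode l) ∈ typeCode g p ∧
        i = Nat.pair (Nat.pair (n + k) (recode (joinVar n) f))
          (listCode ((List.range n).map (Nat.pair 1) ++ l.map (Nat.pair 0))) := by
      refine .ex (.ex (.ex (.and (by fun_prop) (.eq (by fun_prop) (.natPair (.natPair (by fun_prop)
        (hj (by fun_prop))) (by fun_prop))))))
    refine this.of_iff fun i => ⟨?_, ?_⟩
    · rintro ⟨q, hq, rfl⟩
      refine ⟨q.1, formulaCode g (sumVarCode n q.1) q.2.1, List.ofFn fun i => (q.2.2 i : ℕ),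
        ⟨q, hq, (pfCode_eq g q).symm⟩, ?_⟩
      rw [recode_joinVar, ← hs]
      rfl
    · rintro ⟨k, f, l, ⟨q, hq, hc⟩, rfl⟩
      rw [pfCode_eq, Nat.pair_eq_pair, Nat.pair_eq_pair] at hc
      obtain ⟨⟨rfl, rfl⟩, hl⟩ := hc
      rw [listCode_injective hl, recode_joinVar, ← hs]
      exact ⟨q, hq, rfl⟩
  obtain ⟨N', hN', hdec, κ, hκ, hr⟩ := hN.exists_extension hc₀ hindex fun m => by
    choose Q hQ hQ' using fun i : {i : Fin m // ∃ q ∈ p, (i : ℕ) = index q} => i.2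
    obtain ⟨v, hv⟩ := hp.exists_realize Q hQ
    refine ⟨listCode (List.ofFn fun i => (v i : ℕ)), fun i hi hi' => ?_⟩
    have hi'' := hQ' ⟨⟨i, hi⟩, hi'⟩
    have hv := hv ⟨⟨i, hi⟩, hi'⟩
    generalize Q ⟨⟨i, hi⟩, hi'⟩ = q at hi'' hv
    obtain rfl : i = index q := hi''
    rw [indexRel_pair, hs]
    have hproj : ((List.range n).map (Nat.pair 1)).map (indexFun N.carrier (elemDiagram g N) c₀
        (listCode (List.ofFn fun i => (v i : ℕ)))) = List.ofFn fun i => (h.emb (v i) : ℕ) := by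
      rw [hrange, List.map_ofFn]
      refine congrArg _ (funext fun i => ?_)
      have hi : (List.ofFn fun i => (v i : ℕ)).getD i 0 = v i := by simp
      exact (indexFun_proj (hi ▸ h.subset (v i).2)).trans hi
    have hconst : ((List.ofFn fun i => (q.2.2 i : ℕ)).map (Nat.pair 0)).map
        (indexFun N.carrier (elemDiagram g N) c₀ (listCode (List.ofFn fun i => (v i : ℕ)))) =
        List.ofFn fun i => (h.emb (q.2.2 i) : ℕ) := by
      rw [List.map_ofFn, List.map_ofFn]
      exact congrArg _ (funext fun i => indexFun_const (h.subset (q.2.2 i).2) _)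
    rw [List.map_append, hproj, hconst]
    refine (mem_elemDiagram_joinFormula_iff g).2 ⟨_, rfl, ?_⟩
    have := (h.emb.map_formula q.2.1 _).2 hv
    rwa [Sum.comp_elim] at this
  refine ⟨N', h.trans hN', hdec, fun i => κ (Nat.pair 1 i), fun q hq => ?_⟩
  have := hr _ _ (s q) ⟨q, hq, rfl⟩
  have hv : (fun i => κ (s q i)) = Fin.append (fun i => κ (Nat.pair 1 i))
      fun i => ⟨(q.2.2 i : ℕ), (h.trans hN').subset (q.2.2 i).2⟩ := by
    ext i
    refine Fin.addCases (fun i => ?_) (fun i => ?_) i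
    · simp [s]
    · simp only [s, Fin.append_right]
      exact hκ _ (h.subset (q.2.2 i).2)
  rw [hv] at this
  exact (realize_joinFormula q.2.1 _ _).1 this

end Types

/-- **Characterization of arithmetic types**: for an `n`-type `p` over an arithmetical set
`A` inside an arithmetically extendible model `M`, being arithmetic, being realized in an
arithmetically decidable elementary extension, and being realized in an arithmetically
extendible elementary extension are all equivalent. -/
theorem arith_type_realized
    (L : FirstOrder.Language) (g : GoedelCoding L) (hL : ArithLang g)
    (T : L.Theory) (hT : ArithTheory g T) (hcomp : T.IsComplete)
    (hnf : NoFiniteModels L T)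
    (M : CodedStructure L) (hM : M.Models T) (hext : ArithExtendible g T M)
    (A : Set ℕ) (hA : A ⊆ M.carrier) (hAar : IsArithmetical A)
    (n : ℕ) (p : Set (ParamFormula L M n)) (hp : IsNType M A n p) :
    (IsArithmetical (typeCode g p) ↔
      ∃ (N : CodedStructure L) (h : ElemSub M N),
        ArithDecidable g N ∧ RealizesType h.subset p) ∧
    ((∃ (N : CodedStructure L) (h : ElemSub M N),
        ArithDecidable g N ∧ RealizesType h.subset p) ↔
      ∃ (N : CodedStructure L) (h : ElemSub M N),
        ArithExtendible g T N ∧ RealizesType h.subset p) := by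
  have h32 : (∃ (N : CodedStructure L) (h : ElemSub M N),
      ArithExtendible g T N ∧ RealizesType h.subset p) →
      ∃ (N : CodedStructure L) (h : ElemSub M N), ArithDecidable g N ∧ RealizesType h.subset p := by
    rintro ⟨N, h, ⟨N', hN', -, h'⟩, hr⟩
    exact ⟨N', h.trans h', hN', hr.mono h h'⟩
  refine ⟨⟨fun har => ?_, fun ⟨N, h, hN, hr⟩ => hp.isArithmetical hA hAar h hN hr⟩,
    fun ⟨N, h, hN, hr⟩ => ⟨N, h, ⟨N, hN, h.models hM, .refl N⟩, hr⟩, h32⟩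
  obtain ⟨N, hN, hNT, h⟩ := hext
  have := hnf N.carrier N.struc hNT
  exact hp.2.1.exists_arithDecidable har h hN (Set.nonempty_coe_sort.1 inferInstance)

end ArMorley
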